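/- Let A be a commutative Noetherian ring of Krull dimension zero and let R = A[x_1,...,x_n] be a polynomial ring over A. Then for every ideal I of R, every integer i ≥ 0, every prime ideal P of R, and every integer j ≥ 0, the Bass number μ_j(P, H^i_I(R)) is finite. -/

import Mathlib

/-!
STATEMENT 2: Let `A` be a commutative Noetherian ring of Krull dimension zero and let
`R` be a polynomial ring in `n` variables over `A`.  Then for every ideal `I` of `R`,
every `i ≥ 0`, every prime ideal `P` of `R` and every `j ≥ 0`, the Bass number
`μ_j(P, H^i_I(R)) = dim_{κ(P)} Ext^j_{R_P}(κ(P), H^i_I(R)_P)` is finite.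

Since `Ext^j_{R_P}(κ(P), -)` is a `κ(P)`-vector space, finiteness of its dimension over
`κ(P)` is expressed as finite generation of this `Ext` module over the localization `R_P`.
-/

universe u

open CategoryTheory

/-- The Ext module `Ext^j_{R_P}(κ(P), M_P)` whose `κ(P)`-dimension is the `j`-th Bass
number `μ_j(P, M)` of the `R`-module `M` with respect to the prime ideal `P`. -/
noncomputable def bassExtModule (R : Type u) [CommRing R] (P : Ideal R) [P.IsPrime] (j : ℕ)
    (M : ModuleCat.{u} R) : ModuleCat.{u} (Localization.AtPrime P) :=
  ((Ext (Localization.AtPrime P) (ModuleCat.{u} (Localization.AtPrime P)) j).obj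
    (Opposite.op (ModuleCat.of _ (IsLocalRing.ResidueField (Localization.AtPrime P))))).obj
    (ModuleCat.of _ (LocalizedModule P.primeCompl M))

namespace BassLC

open Abelian HomologicalComplex

section S1
variable {R : Type u} [CommRing R]

lemma extMk_zero_iff_zero {X Y : ModuleCat.{u} R} (P : ProjectiveResolution X)
    (f : P.complex.X 0 ⟶ Y) (hf : P.complex.d 1 0 ≫ f = 0) :
    P.extMk f 1 rfl hf = 0 ↔ f = 0 := by
  simp only [← P.extEquivCohomologyClass.apply_eq_iff_eq,
    ProjectiveResolution.extEquivCohomologyClass_extMk,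
    ProjectiveResolution.extEquivCohomologyClass_zero,
    CochainComplex.HomComplex.CohomologyClass.mk_eq_zero_iff]
  rw [CochainComplex.HomComplex.Cocycle.toSingleMk_mem_coboundaries_iff _ _ _ _ _ 1 (by simp)]
  constructor
  · rintro ⟨g, hg⟩
    have : g = 0 := (CochainComplex.isZero_of_isStrictlyLE P.cochainComplex 0 1
      (by simp)).eq_of_src _ _
    subst this
    rw [← cancel_epi (P.cochainComplexXIso (-(0:ℕ)) 0 rfl).hom]
    simpa using hg.symm
  · rintro rfl
    exact ⟨0, by simp⟩

/-- cocycles of degree n -/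
def cocyc {X : ModuleCat.{u} R} (P : ProjectiveResolution X) (Y : ModuleCat.{u} R) (n : ℕ) :
    Submodule R (P.complex.X n ⟶ Y) where
  carrier := {f | P.complex.d (n+1) n ≫ f = 0}
  add_mem' := by intro a b ha hb; simp_all
  zero_mem' := by simp
  smul_mem' := by intro c f hf; simp_all

lemma cocyc_cond {X : ModuleCat.{u} R} {P : ProjectiveResolution X} {Y : ModuleCat.{u} R} {n : ℕ}
    (f : cocyc P Y n) : P.complex.d (n+1) n ≫ f.1 = 0 := f.2

noncomputable def cocycToExt {X : ModuleCat.{u} R} (P : ProjectiveResolution X)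
    (Y : ModuleCat.{u} R) (n : ℕ) :
    cocyc P Y n →ₗ[R] Abelian.Ext X Y n where
  toFun f := P.extMk f.1 (n+1) rfl (cocyc_cond f)
  map_add' f g := (P.add_extMk _ _ _ _ _ _).symm
  map_smul' c f := by
    simp only [RingHom.id_apply]
    rw [Abelian.Ext.smul_eq_comp_mk₀, P.extMk_comp_mk₀]
    congr 1

lemma cocycToExt_apply {X : ModuleCat.{u} R} (P : ProjectiveResolution X)
    (Y : ModuleCat.{u} R) (n : ℕ) (f : cocyc P Y n) :
    cocycToExt P Y n f = P.extMk f.1 (n+1) rfl (cocyc_cond f) := rfl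

lemma cocycToExt_surjective {X : ModuleCat.{u} R} (P : ProjectiveResolution X)
    (Y : ModuleCat.{u} R) (n : ℕ) : Function.Surjective (cocycToExt P Y n) := by
  intro y
  obtain ⟨f, hf, h⟩ := P.extMk_surjective y (n+1) rfl
  exact ⟨⟨f, hf⟩, h⟩

/-- the coboundary condition -/
def IsCob {X : ModuleCat.{u} R} (P : ProjectiveResolution X)
    (Y : ModuleCat.{u} R) (n : ℕ) (f : P.complex.X n ⟶ Y) : Prop :=
  match n, f with
  | 0, f => f = 0
  | p+1, f => ∃ g : P.complex.X p ⟶ Y, P.complex.d (p+1) p ≫ g = f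

lemma cocycToExt_eq_zero {X : ModuleCat.{u} R} (P : ProjectiveResolution X)
    (Y : ModuleCat.{u} R) (n : ℕ) (f : cocyc P Y n) :
    cocycToExt P Y n f = 0 ↔ IsCob P Y n f.1 := by
  cases n with
  | zero => exact extMk_zero_iff_zero P f.1 f.2
  | succ p => exact P.extMk_eq_zero_iff f.1 _ rfl f.2 p rfl

section cyc
variable (K L : CochainComplex (ModuleCat.{u} R) ℕ) (n : ℕ)

noncomputable def cycLift : LinearMap.ker (K.d n (n+1)).hom →ₗ[R] K.cycles n :=
  (K.liftCycles (ModuleCat.ofHom (LinearMap.ker (K.d n (n+1)).hom).subtype) (n+1) (by simp)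
      (by ext f; exact f.2)).hom

lemma iCycles_cycLift (x : LinearMap.ker (K.d n (n+1)).hom) :
    K.iCycles n (cycLift K n x) = x.1 := by
  change ((K.liftCycles (ModuleCat.ofHom (LinearMap.ker (K.d n (n+1)).hom).subtype) (n+1) (by simp)
      (by ext f; exact f.2)) ≫ K.iCycles n) x = _
  rw [HomologicalComplex.liftCycles_i]
  rfl

lemma iCycles_inj : Function.Injective (K.iCycles n) :=
  (ModuleCat.mono_iff_injective (K.iCycles n)).1 inferInstance

lemma cycLift_surj : Function.Surjective (cycLift K n) := by
  intro z
  have hz : K.d n (n+1) (K.iCycles n z) = 0 := by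
    rw [← ModuleCat.comp_apply, HomologicalComplex.iCycles_d]; rfl
  refine ⟨⟨K.iCycles n z, hz⟩, ?_⟩
  apply iCycles_inj
  rw [iCycles_cycLift]

noncomputable def cycTo : LinearMap.ker (K.d n (n+1)).hom →ₗ[R] K.homology n :=
  (K.homologyπ n).hom ∘ₗ cycLift K n

lemma cycTo_surj : Function.Surjective (cycTo K n) := by
  have h2 : Function.Surjective (K.homologyπ n).hom :=
    (ModuleCat.epi_iff_surjective _).1 inferInstance
  exact h2.comp (cycLift_surj K n)

lemma cycTo_zero (x : LinearMap.ker (K.d 0 (0+1)).hom) : cycTo K 0 x = 0 ↔ x.1 = 0 := by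
  have h2 : Function.Injective (K.homologyπ 0).hom :=
    (ModuleCat.mono_iff_injective _).1 inferInstance
  change (K.homologyπ 0).hom _ = 0 ↔ _
  rw [map_eq_zero_iff _ h2]
  constructor
  · intro h; rw [← iCycles_cycLift, h, map_zero]
  · intro h
    apply iCycles_inj; rw [iCycles_cycLift, h, map_zero]

lemma cycTo_succ (x : LinearMap.ker (K.d (n+1) (n+1+1)).hom) :
    cycTo K (n+1) x = 0 ↔ ∃ y, K.d n (n+1) y = x.1 := by
  have hex : (ShortComplex.mk _ _ (K.toCycles_comp_homologyπ n (n+1))).Exact :=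
    ShortComplex.exact_of_g_is_cokernel _ (K.homologyIsCokernel n (n+1) (by simp))
  rw [ShortComplex.moduleCat_exact_iff] at hex
  constructor
  · intro h
    obtain ⟨y, hy⟩ := hex _ h
    refine ⟨y, ?_⟩
    rw [← iCycles_cycLift, ← hy]
    change _ = (K.toCycles n (n+1) ≫ K.iCycles (n+1)) y
    rw [K.toCycles_i]
  · rintro ⟨y, hy⟩
    have : K.toCycles n (n+1) y = cycLift K (n+1) x := by
      apply iCycles_inj
      rw [iCycles_cycLift, ← hy, ← ModuleCat.comp_apply, K.toCycles_i]
    change (K.homologyπ (n+1)) _ = 0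
    rw [← this, ← ModuleCat.comp_apply, K.toCycles_comp_homologyπ]
    rfl

variable {K L} in
lemma cycTo_nat (φ : K ⟶ L) (x : LinearMap.ker (K.d n (n+1)).hom)
    (y : LinearMap.ker (L.d n (n+1)).hom) (h : y.1 = φ.f n x.1) :
    homologyMap φ n (cycTo K n x) = cycTo L n y := by
  change (K.homologyπ n ≫ homologyMap φ n) (cycLift K n x) = L.homologyπ n (cycLift L n y)
  rw [HomologicalComplex.homologyπ_naturality, ModuleCat.comp_apply]
  congr 1
  apply iCycles_inj
  rw [iCycles_cycLift, h, ← ModuleCat.comp_apply, HomologicalComplex.cyclesMap_i,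
    ModuleCat.comp_apply, iCycles_cycLift]

end cyc

noncomputable def cocycToOld {X : ModuleCat.{u} R} (P : ProjectiveResolution X)
    (Y : ModuleCat.{u} R) (n : ℕ) :
    cocyc P Y n →ₗ[R] (((_root_.Ext R (ModuleCat.{u} R) n).obj (Opposite.op X)).obj Y) :=
  (P.isoExt n Y).inv.hom ∘ₗ (cycTo (P.complex.linearYonedaObj R Y) n : _)

lemma cocycToOld_surjective {X : ModuleCat.{u} R} (P : ProjectiveResolution X)
    (Y : ModuleCat.{u} R) (n : ℕ) : Function.Surjective (cocycToOld P Y n) := by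
  have h1 : Function.Surjective (P.isoExt (R := R) n Y).inv.hom :=
    (ModuleCat.epi_iff_surjective _).1 inferInstance
  exact h1.comp (cycTo_surj _ n)

lemma cocycToOld_eq_zero {X : ModuleCat.{u} R} (P : ProjectiveResolution X)
    (Y : ModuleCat.{u} R) (n : ℕ) (f : cocyc P Y n) :
    cocycToOld P Y n f = 0 ↔ IsCob P Y n f.1 := by
  have h1 : Function.Injective (P.isoExt (R := R) n Y).inv.hom :=
    (ModuleCat.mono_iff_injective _).1 inferInstance
  have key : cocycToOld P Y n f = 0 ↔ cycTo (P.complex.linearYonedaObj R Y) n f = 0 := by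
    change (P.isoExt (R := R) n Y).inv.hom _ = 0 ↔ _
    rw [map_eq_zero_iff _ h1]
    exact Iff.rfl
  rw [key]
  cases n with
  | zero => exact cycTo_zero _ _
  | succ p => exact cycTo_succ _ _ _

noncomputable def oldEquiv {X : ModuleCat.{u} R} (P : ProjectiveResolution X)
    (Y : ModuleCat.{u} R) (n : ℕ) :
    (((_root_.Ext R (ModuleCat.{u} R) n).obj (Opposite.op X)).obj Y) ≃ₗ[R] Abelian.Ext X Y n :=
  ((cocycToOld P Y n).quotKerEquivOfSurjective (cocycToOld_surjective P Y n)).symm ≪≫ₗ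
  (Submodule.quotEquivOfEq _ _ (by
    ext f; simp only [LinearMap.mem_ker, cocycToOld_eq_zero, cocycToExt_eq_zero])) ≪≫ₗ
  ((cocycToExt P Y n).quotKerEquivOfSurjective (cocycToExt_surjective P Y n))

lemma oldEquiv_cocyc {X : ModuleCat.{u} R} (P : ProjectiveResolution X)
    (Y : ModuleCat.{u} R) (n : ℕ) (f : cocyc P Y n) :
    oldEquiv P Y n (cocycToOld P Y n f) = cocycToExt P Y n f := by
  have : ((cocycToOld P Y n).quotKerEquivOfSurjective (cocycToOld_surjective P Y n)).symm
      (cocycToOld P Y n f) = Submodule.Quotient.mk f := by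
    rw [LinearEquiv.symm_apply_eq]; rfl
  simp only [oldEquiv, LinearEquiv.trans_apply]
  rw [this]
  rfl

lemma homologyUnop_nat {K L : ChainComplex (ModuleCat.{u} R)ᵒᵖ ℕ} (ψ : K ⟶ L) (n : ℕ) :
    (HomologicalComplex.homologyUnop L n).hom ≫ (homologyMap ψ n).unop =
    homologyMap ((HomologicalComplex.unopFunctor _ _).map ψ.op) n ≫
      (HomologicalComplex.homologyUnop K n).hom :=
  congrArg Quiver.Hom.unop (HomologicalComplex.homologyOp_hom_naturality
    ((HomologicalComplex.unopFunctor _ _).map ψ.op) n)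

lemma isoExt_nat {X X' : ModuleCat.{u} R} (P : ProjectiveResolution X)
    (P' : ProjectiveResolution X') (g : X' ⟶ X) (φ : ProjectiveResolution.Hom P' P g)
    (Y : ModuleCat.{u} R) (n : ℕ) :
    (P.isoExt n Y).inv ≫ ((_root_.Ext R (ModuleCat.{u} R) n).map g.op).app Y =
    homologyMap (K := P.complex.linearYonedaObj R Y) (L := P'.complex.linearYonedaObj R Y)
    ((HomologicalComplex.unopFunctor _ _).map
      ((((linearYoneda R (ModuleCat.{u} R)).obj Y).rightOp.mapHomologicalComplex _).map φ.hom).op) n ≫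
      (P'.isoExt n Y).inv := by
  have := ProjectiveResolution.isoLeftDerivedObj_hom_naturality g P' P φ.hom
    φ.hom_f_zero_comp_π_f_zero (((linearYoneda R (ModuleCat.{u} R)).obj Y).rightOp) n
  have := congrArg Quiver.Hom.unop this
  have h2 := homologyUnop_nat
    ((((linearYoneda R (ModuleCat.{u} R)).obj Y).rightOp.mapHomologicalComplex _).map φ.hom) n
  refine (Category.assoc (HomologicalComplex.homologyUnop _ n).hom
    (P.isoLeftDerivedObj (((linearYoneda R (ModuleCat.{u} R)).obj Y).rightOp) n).hom.unop _).trans ?_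
  refine (congrArg (fun t => (HomologicalComplex.homologyUnop _ n).hom ≫ t) this).trans ?_
  refine ((Category.assoc _ _ _).symm.trans
    (congrArg (fun t => t ≫ (P'.isoLeftDerivedObj
      (((linearYoneda R (ModuleCat.{u} R)).obj Y).rightOp) n).hom.unop) h2)).trans ?_
  exact (Category.assoc _ _ _)

lemma cocycToOld_nat {X X' : ModuleCat.{u} R} (P : ProjectiveResolution X)
    (P' : ProjectiveResolution X') (g : X' ⟶ X) (φ : ProjectiveResolution.Hom P' P g)
    (Y : ModuleCat.{u} R) (n : ℕ) (f : cocyc P Y n) :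
    ((_root_.Ext R (ModuleCat.{u} R) n).map g.op).app Y (cocycToOld P Y n f) =
      cocycToOld P' Y n ⟨φ.hom.f n ≫ f.1, by
        change _ ≫ _ = 0
        rw [← φ.hom.comm_assoc, cocyc_cond, Limits.comp_zero]⟩ := by
  change ((P.isoExt n Y).inv ≫ ((_root_.Ext R (ModuleCat.{u} R) n).map g.op).app Y)
    (cycTo (P.complex.linearYonedaObj R Y) n f) = _
  rw [isoExt_nat P P' g φ]
  change (P'.isoExt n Y).inv _ = (P'.isoExt n Y).inv _
  congr 1
  exact cycTo_nat n _ _ _ rfl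

noncomputable def liftHom {X X' : ModuleCat.{u} R} (P : ProjectiveResolution X)
    (P' : ProjectiveResolution X') (g : X' ⟶ X) : ProjectiveResolution.Hom P' P g where
  hom := ProjectiveResolution.lift g P' P
  hom_f_zero_comp_π_f_zero := ProjectiveResolution.lift_commutes_zero _ _ _

lemma oldEquiv_nat {X X' : ModuleCat.{u} R} (P : ProjectiveResolution X)
    (P' : ProjectiveResolution X') (g : X' ⟶ X)
    (Y : ModuleCat.{u} R) (n : ℕ)
    (x : ((_root_.Ext R (ModuleCat.{u} R) n).obj (Opposite.op X)).obj Y) :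
    oldEquiv P' Y n (((_root_.Ext R (ModuleCat.{u} R) n).map g.op).app Y x) =
      (Abelian.Ext.mk₀ g).comp (oldEquiv P Y n x) (zero_add n) := by
  obtain ⟨f, rfl⟩ := cocycToOld_surjective P Y n x
  rw [cocycToOld_nat P P' g (liftHom P P' g), oldEquiv_cocyc, oldEquiv_cocyc,
    cocycToExt_apply, cocycToExt_apply, ProjectiveResolution.mk₀_comp_extMk _ _ _ _ (liftHom P P' g)]

end S1
end BassLC

namespace BassLC

section S2
variable {R : Type u} [CommRing R]

/-- `H` is the direct limit of the sequence `D` -/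
structure IsDL (D : ℕ → Type u) [∀ k, AddCommGroup (D k)] [∀ k, Module R (D k)]
    (t : ∀ k l, k ≤ l → D k →ₗ[R] D l) (H : Type u) [AddCommGroup H] [Module R H]
    (ι : ∀ k, D k →ₗ[R] H) : Prop where
  compat : ∀ k l h x, ι l (t k l h x) = ι k x
  surj : ∀ y, ∃ k x, ι k x = y
  zero : ∀ k x, ι k x = 0 → ∃ l h, t k l h x = 0

section
variable {D : ℕ → Type u} [∀ k, AddCommGroup (D k)] [∀ k, Module R (D k)]
    {t : ∀ k l, k ≤ l → D k →ₗ[R] D l} {H : Type u} [AddCommGroup H] [Module R H]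
    {ι : ∀ k, D k →ₗ[R] H}
  {D' : ℕ → Type u} [∀ k, AddCommGroup (D' k)] [∀ k, Module R (D' k)]
    {t' : ∀ k l, k ≤ l → D' k →ₗ[R] D' l} {H' : Type u} [AddCommGroup H'] [Module R H']
    {ι' : ∀ k, D' k →ₗ[R] H'}

/-- comparison of direct limits -/
theorem IsDL.equiv (h : IsDL D t H ι) (h' : IsDL D' t' H' ι')
    (α : ∀ k, D k →ₗ[R] D' k) (hα : ∀ k l hkl x, α l (t k l hkl x) = t' k l hkl (α k x))
    (inj : ∀ k x, α k x = 0 → ∃ l h, t k l h x = 0)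
    (surj : ∀ k y, ∃ l h x, α l x = t' k l h y) : Nonempty (H ≃ₗ[R] H') := by
  -- graph submodule
  let G : Submodule R (H × H') :=
    { carrier := {p | ∃ k x, ι k x = p.1 ∧ ι' k (α k x) = p.2}
      add_mem' := by
        rintro ⟨a, b⟩ ⟨a', b'⟩ ⟨k, x, hx, hx'⟩ ⟨l, y, hy, hy'⟩
        refine ⟨max k l, t k _ (le_max_left k l) x + t l _ (le_max_right k l) y, ?_, ?_⟩
        · rw [map_add, h.compat, h.compat, hx, hy]; rfl
        · rw [map_add, map_add, hα, hα, h'.compat, h'.compat, hx', hy']; rfl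
      zero_mem' := ⟨0, 0, by simp, by simp⟩
      smul_mem' := by
        rintro c ⟨a, b⟩ ⟨k, x, hx, hx'⟩
        exact ⟨k, c • x, by simp_all, by simp_all⟩ }
  have b1 : Function.Bijective ((LinearMap.fst R H H').comp G.subtype) := by
    constructor
    · rw [← LinearMap.ker_eq_bot, LinearMap.ker_eq_bot']
      rintro ⟨⟨a, b⟩, k, x, hx, hx'⟩ h0
      obtain rfl : a = 0 := h0
      obtain ⟨l, hl, h1⟩ := h.zero _ _ hx
      have : b = 0 := by
        change _ = b at hx'
        rw [← hx', ← h'.compat k l hl, ← hα, h1, map_zero, map_zero]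
      ext <;> simp [this]
    · intro y
      obtain ⟨k, x, hx⟩ := h.surj y
      exact ⟨⟨(y, ι' k (α k x)), k, x, hx, rfl⟩, rfl⟩
  have b2 : Function.Bijective ((LinearMap.snd R H H').comp G.subtype) := by
    constructor
    · rw [← LinearMap.ker_eq_bot, LinearMap.ker_eq_bot']
      rintro ⟨⟨a, b⟩, k, x, hx, hx'⟩ h0
      obtain rfl : b = 0 := h0
      obtain ⟨l, hl, h1⟩ := h'.zero _ _ hx'
      rw [← hα] at h1
      obtain ⟨m, hm, h2⟩ := inj _ _ h1
      have : a = 0 := by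
        change _ = a at hx
        rw [← hx, ← h.compat k l hl, ← h.compat l m hm, h2, map_zero]
      ext <;> simp [this]
    · intro y
      obtain ⟨k, z, hz⟩ := h'.surj y
      obtain ⟨l, hl, x, hx⟩ := surj k z
      exact ⟨⟨(ι l x, y), l, x, rfl, by rw [hx, h'.compat, hz]⟩, rfl⟩
  exact ⟨(LinearEquiv.ofBijective _ b1).symm ≪≫ₗ LinearEquiv.ofBijective _ b2⟩

end

/-- The system `Ext^i(R/I^k, M)`. -/
noncomputable def quotMap (I : Ideal R) (k l : ℕ) (h : k ≤ l) :
    ModuleCat.of R (R ⧸ I ^ l) ⟶ ModuleCat.of R (R ⧸ I ^ k) :=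
  ModuleCat.ofHom (Submodule.mapQ _ _ LinearMap.id (Ideal.pow_le_pow_right h))

abbrev EX (I : Ideal R) (M : ModuleCat.{u} R) (i k : ℕ) : Type u :=
  Abelian.Ext (ModuleCat.of R (R ⧸ I ^ k)) M i

noncomputable def exMap (I : Ideal R) (M : ModuleCat.{u} R) (i k l : ℕ) (h : k ≤ l) :
    EX I M i k →ₗ[R] EX I M i l where
  toFun x := (Abelian.Ext.mk₀ (quotMap I k l h)).comp x (zero_add i)
  map_add' := by simp
  map_smul' := by simp

theorem localCohomology_isDL (I : Ideal R) (i : ℕ) (M : ModuleCat.{u} R) :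
    ∃ ι, IsDL (EX I M i) (exMap I M i) ((localCohomology I i).obj M) ι := by
  let F := localCohomology.diagram (localCohomology.idealPowersDiagram I) i
  have hc := Limits.isColimitOfPreserves ((evaluation _ _).obj M) (Limits.colimit.isColimit F)
  have : IsCofiltered ℕᵒᵖ := isCofiltered_op_of_isFiltered ℕ
  have : IsFiltered ℕᵒᵖᵒᵖ := isFiltered_op_of_isCofiltered ℕᵒᵖ
  have : Limits.PreservesFilteredColimitsOfSize.{0, 0} (forget (ModuleCat.{u} R)) :=
    Limits.preservesFilteredColimitsOfSize_shrink _
  have : Limits.PreservesColimit (F ⋙ (evaluation (ModuleCat R) (ModuleCat R)).obj M)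
    (forget (ModuleCat.{u} R)) := inferInstance
  let P := fun k : ℕ => projectiveResolution (ModuleCat.of R (R ⧸ I ^ k))
  let o := fun k : ℕ => (oldEquiv (P k) M i)
  let j : ∀ k : ℕ, (((_root_.Ext R (ModuleCat.{u} R) i).obj (Opposite.op (ModuleCat.of R (R ⧸ I ^ k)))).obj M) →ₗ[R] ((localCohomology I i).obj M) :=
    fun k => (((Limits.colimit.ι F (Opposite.op (Opposite.op k))).app M)).hom
  refine ⟨fun k => j k ∘ₗ (o k).symm.toLinearMap, ?_, ?_, ?_⟩
  · intro k l h x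
    obtain ⟨y, rfl⟩ := (o k).surjective x
    change j l ((o l).symm (Abelian.Ext.comp _ _ (zero_add i))) = j k ((o k).symm (o k y))
    rw [LinearEquiv.symm_apply_apply, ← oldEquiv_nat, LinearEquiv.symm_apply_apply]
    have := congrArg (fun t => t.app M y) (Limits.colimit.w F (homOfLE h).op.op)
    exact this
  · intro y
    obtain ⟨k, x, hx⟩ := Limits.Concrete.isColimit_exists_rep _ hc y
    refine ⟨k.unop.unop, o _ x, ?_⟩
    exact (congrArg (j k.unop.unop)
      ((o k.unop.unop).symm_apply_apply x)).trans hx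
  · intro k x hx
    obtain ⟨y, rfl⟩ := (o k).surjective x
    simp only [LinearMap.comp_apply, LinearEquiv.coe_coe, LinearEquiv.symm_apply_apply] at hx
    obtain ⟨m, f, g, h⟩ := Limits.Concrete.isColimit_exists_of_rep_eq (F ⋙ ((evaluation _ _).obj M)) hc
      (i := Opposite.op (Opposite.op k)) (j := Opposite.op (Opposite.op k)) y 0
      (hx.trans (map_zero (j k)).symm)
    have hkm : k ≤ m.unop.unop := leOfHom f.unop.unop
    refine ⟨m.unop.unop, hkm, ?_⟩
    change (Abelian.Ext.comp _ _ (zero_add i)) = _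
    rw [← oldEquiv_nat (P k) (P m.unop.unop)]
    refine (congrArg (o m.unop.unop) (h.trans (map_zero _))).trans (map_zero _)

end S2
end BassLC

namespace BassLC

section S3
variable {R : Type u} [CommRing R]

/-- The `I`-torsion submodule. -/
def gam (I : Ideal R) (M : Type*) [AddCommGroup M] [Module R M] : Submodule R M where
  carrier := {x | ∃ k : ℕ, ∀ a ∈ I ^ k, a • x = 0}
  add_mem' := by
    rintro x y ⟨k, hk⟩ ⟨l, hl⟩
    refine ⟨max k l, fun a ha => ?_⟩
    rw [smul_add, hk a (Ideal.pow_le_pow_right (le_max_left k l) ha),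
      hl a (Ideal.pow_le_pow_right (le_max_right k l) ha), add_zero]
  zero_mem' := ⟨0, by simp⟩
  smul_mem' := by
    rintro c x ⟨k, hk⟩
    exact ⟨k, fun a ha => by rw [smul_comm, hk a ha, smul_zero]⟩

lemma mem_gam {I : Ideal R} {M : Type*} [AddCommGroup M] [Module R M] {x : M} :
    x ∈ gam I M ↔ ∃ k : ℕ, ∀ a ∈ I ^ k, a • x = 0 := Iff.rfl

lemma gam_uniform {I : Ideal R} {M N : Type*} [AddCommGroup M] [Module R M] [AddCommGroup N]
    [Module R N] [Module.Finite R N] (g : N →ₗ[R] M) (h : ∀ x, g x ∈ gam I M) :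
    ∃ k : ℕ, ∀ a ∈ I ^ k, ∀ x, a • g x = 0 := by
  obtain ⟨s, hs⟩ := (Module.Finite.fg_top : (⊤ : Submodule R N).FG)
  choose k hk using h
  refine ⟨s.sup k, fun a ha x => ?_⟩
  have : x ∈ Submodule.span R (s : Set N) := by rw [hs]; trivial
  induction this using Submodule.span_induction with
  | mem x hx => exact hk x a (Ideal.pow_le_pow_right (Finset.le_sup hx) ha)
  | zero => simp
  | add x y _ _ hx hy => rw [map_add, smul_add, hx, hy, add_zero]
  | smul c x _ hx => rw [map_smul, smul_comm, hx, smul_zero]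

lemma gam_injective [IsNoetherianRing R] (I : Ideal R) (E : Type u) [AddCommGroup E] [Module R E]
    [Module.Injective R E] : Module.Injective R (gam I E) := by
  apply Module.Baer.injective
  intro J g
  obtain ⟨c, hc⟩ := gam_uniform (I := I) ((gam I E).subtype ∘ₗ g) (fun x => (g x).2)
  obtain ⟨k, hk⟩ := Ideal.exists_pow_inf_eq_pow_smul I (M := R) J
  let n := c + k
  let π : J →ₗ[R] (R ⧸ I ^ n) := (I ^ n).mkQ ∘ₗ J.subtype
  have hker : LinearMap.ker π ≤ LinearMap.ker g := by
    intro x hx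
    have hx1 : x.1 ∈ I ^ n := by
      have : (Submodule.Quotient.mk x.1 : R ⧸ I ^ n) = 0 := hx
      rwa [Submodule.Quotient.mk_eq_zero] at this
    have hx2 : x.1 ∈ I ^ c • J := by
      have : x.1 ∈ I ^ n • ⊤ ⊓ J := ⟨by simpa using hx1, x.2⟩
      rw [hk n (by omega)] at this
      have e : n - k = c := by omega
      rw [e] at this
      exact Submodule.smul_mono le_rfl inf_le_right this
    have hx3 : ∀ y, (hy : y ∈ I ^ c • J) → ∃ h : y ∈ J, g ⟨y, h⟩ = 0 := by
      intro y hy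
      refine Submodule.smul_induction_on hy ?_ ?_
      · intro a ha m hm
        refine ⟨J.smul_mem a hm, ?_⟩
        have : (⟨a • m, J.smul_mem a hm⟩ : J) = a • ⟨m, hm⟩ := rfl
        rw [this, map_smul]
        ext
        exact hc a ha ⟨m, hm⟩
      · rintro y z ⟨h, hy⟩ ⟨h', hz⟩
        refine ⟨J.add_mem h h', ?_⟩
        have : (⟨y + z, J.add_mem h h'⟩ : J) = ⟨y, h⟩ + ⟨z, h'⟩ := rfl
        rw [this, map_add, hy, hz, add_zero]
    obtain ⟨_, h⟩ := hx3 x.1 hx2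
    exact h
  let g1 : (J ⧸ LinearMap.ker π) →ₗ[R] E := (gam I E).subtype ∘ₗ (LinearMap.ker π).liftQ g hker
  let π1 : (J ⧸ LinearMap.ker π) →ₗ[R] (R ⧸ I ^ n) := (LinearMap.ker π).liftQ π le_rfl
  have hπ1 : Function.Injective π1 := by
    rw [← LinearMap.ker_eq_bot]
    exact Submodule.ker_liftQ_eq_bot _ _ _ le_rfl
  obtain ⟨h, hh⟩ := Module.Injective.out π1 hπ1 g1
  refine ⟨(h ∘ₗ (I ^ n).mkQ).codRestrict _ (fun x => ⟨n, fun a ha => ?_⟩), fun x hx => ?_⟩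
  · rw [← map_smul]
    have : a • x ∈ I ^ n := Ideal.mul_mem_right _ _ ha
    have : (I ^ n).mkQ (a • x) = 0 := by simpa using (Submodule.Quotient.mk_eq_zero _).2 this
    rw [LinearMap.comp_apply, this, map_zero]
  · ext
    exact hh (Submodule.Quotient.mk ⟨x, hx⟩)

/-- short exact sequences -/
lemma mkSES {A B C : Type u} [AddCommGroup A] [Module R A] [AddCommGroup B] [Module R B]
    [AddCommGroup C] [Module R C] (f : A →ₗ[R] B) (g : B →ₗ[R] C) (hf : Function.Injective f)
    (hg : Function.Surjective g) (h : Function.Exact f g) :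
    (ShortComplex.mk (ModuleCat.ofHom f) (ModuleCat.ofHom g)
      (by ext x; exact h.apply_apply_eq_zero x)).ShortExact where
  exact := by
    rw [ShortComplex.moduleCat_exact_iff]
    intro x hx
    exact (h x).1 hx
  mono_f := (ModuleCat.mono_iff_injective _).2 hf
  epi_g := (ModuleCat.epi_iff_surjective _).2 hg

lemma exMap_comp {I : Ideal R} {M N : ModuleCat.{u} R} {i j n k l : ℕ} (h : k ≤ l)
    (x : EX I M i k) (y : Abelian.Ext M N j) (hn : i + j = n) :
    exMap I N n k l h (x.comp y hn) = (exMap I M i k l h x).comp y hn := by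
  change (Abelian.Ext.mk₀ _).comp _ (zero_add n) = Abelian.Ext.comp (Abelian.Ext.comp _ _ (zero_add i)) _ _
  rw [Abelian.Ext.comp_assoc]
  omega

lemma exMap_mk₀ {I : Ideal R} {M : ModuleCat.{u} R} {k l : ℕ} (h : k ≤ l)
    (f : ModuleCat.of R (R ⧸ I ^ k) ⟶ M) :
    exMap I M 0 k l h (Abelian.Ext.mk₀ f) = Abelian.Ext.mk₀ (quotMap I k l h ≫ f) := by
  change Abelian.Ext.comp _ _ (zero_add 0) = _
  simp

lemma exMap_trans {I : Ideal R} {M : ModuleCat.{u} R} {i k l m : ℕ} (h : k ≤ l) (h' : l ≤ m)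
    (x : EX I M i k) :
    exMap I M i l m h' (exMap I M i k l h x) = exMap I M i k m (h.trans h') x := by
  change Abelian.Ext.comp _ (Abelian.Ext.comp _ _ (zero_add i)) (zero_add i) =
    Abelian.Ext.comp _ _ (zero_add i)
  rw [Abelian.Ext.mk₀_comp_mk₀_assoc]
  congr 2
  ext
  rfl

/-- a hom `R/I^k → M` attached to an element killed by `I^k` -/
noncomputable def homOfElt {I : Ideal R} {M : ModuleCat.{u} R} {k : ℕ} (x : M)
    (hx : ∀ a ∈ I ^ k, a • x = 0) : ModuleCat.of R (R ⧸ I ^ k) ⟶ M :=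
  ModuleCat.ofHom ((I ^ k).liftQ (LinearMap.toSpanSingleton R M x) (fun a ha => hx a ha))

lemma homOfElt_one {I : Ideal R} {M : ModuleCat.{u} R} {k : ℕ} (x : M)
    (hx : ∀ a ∈ I ^ k, a • x = 0) : homOfElt x hx (Submodule.Quotient.mk 1 : R ⧸ I ^ k) = x :=
  one_smul R x

lemma hom_ext_one {I : Ideal R} {M : ModuleCat.{u} R} {k : ℕ}
    {f g : ModuleCat.of R (R ⧸ I ^ k) ⟶ M}
    (h : f (Submodule.Quotient.mk 1 : R ⧸ I ^ k) = g (Submodule.Quotient.mk 1 : R ⧸ I ^ k)) :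
    f = g := by
  ext : 1
  apply Submodule.linearMap_qext
  apply LinearMap.ext_ring
  exact h

lemma torsion_embed [IsNoetherianRing R] (I : Ideal R) (T : Type u) [AddCommGroup T] [Module R T]
    (hT : gam I T = ⊤) : ∃ (G : Type u) (_ : AddCommGroup G) (_ : Module R G)
      (_ : Module.Injective R G) (_ : gam I G = ⊤) (j : T →ₗ[R] G), Function.Injective j := by
  let E : ModuleCat.{u} R := Injective.under (ModuleCat.of R T)
  have hE0 : Injective E := Injective.injective_under (ModuleCat.of R T)
  have hE : Module.Injective R E :=
    @Module.injective_module_of_injective_object R E _ _ _ hE0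
  let j : T →ₗ[R] E := (Injective.ι (ModuleCat.of R T)).hom
  have hj : Function.Injective j :=
    (ModuleCat.mono_iff_injective (Injective.ι (ModuleCat.of R T))).1 inferInstance
  refine ⟨gam I E, inferInstance, inferInstance, gam_injective I E, ?_,
    j.codRestrict (gam I E) (fun x => ?_), fun x y h => hj (congrArg Subtype.val h)⟩
  · rw [eq_top_iff]
    rintro ⟨x, k, hk⟩ -
    exact ⟨k, fun a ha => Subtype.ext (hk a ha)⟩
  · have : x ∈ gam I T := by rw [hT]; trivial
    obtain ⟨k, hk⟩ := this
    exact ⟨k, fun a ha => by rw [← map_smul, hk a ha, map_zero]⟩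

/-- almost vanishing of higher Ext for torsion modules -/
theorem torsion_almost_zero [IsNoetherianRing R] (I : Ideal R) (n : ℕ) :
    ∀ (T : Type u) [AddCommGroup T] [Module R T] (_ : gam I T = ⊤) (k : ℕ)
      (x : EX I (ModuleCat.of R T) (n+1) k), ∃ l h, exMap I _ (n+1) k l h x = 0 := by
  induction n with
  | zero =>
    intro T _ _ hT k x
    obtain ⟨G, _, _, hG, hGt, j, hj⟩ := torsion_embed I T hT
    have hS := mkSES j (LinearMap.range j).mkQ hj (Submodule.mkQ_surjective _)
      (LinearMap.exact_map_mkQ_range j)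
    have : Injective (ModuleCat.of R G) := Module.injective_object_of_injective_module R G
    obtain ⟨y, hy⟩ := Abelian.Ext.covariant_sequence_exact₁ _ hS x
      (Abelian.Ext.eq_zero_of_injective _) (zero_add 1)
    obtain ⟨f, rfl⟩ := (Abelian.Ext.mk₀_bijective _ _).2 y
    obtain ⟨e, he⟩ := Submodule.mkQ_surjective _ (f (Submodule.Quotient.mk 1 : R ⧸ I ^ k))
    have : e ∈ gam I G := by rw [hGt]; trivial
    obtain ⟨m, hm⟩ := this
    have hm' : ∀ a ∈ I ^ (max k m), a • e = 0 :=
      fun a ha => hm a (Ideal.pow_le_pow_right (le_max_right k m) ha)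
    refine ⟨max k m, le_max_left _ _, ?_⟩
    rw [← hy, exMap_comp, exMap_mk₀]
    have : quotMap I k (max k m) (le_max_left k m) ≫ f =
        homOfElt (M := ModuleCat.of R G) e hm' ≫ ModuleCat.ofHom (LinearMap.range j).mkQ := by
      apply hom_ext_one
      rw [ModuleCat.comp_apply, ModuleCat.comp_apply, homOfElt_one]
      exact he.symm
    rw [this, ← Abelian.Ext.mk₀_comp_mk₀, Abelian.Ext.comp_assoc _ _ _ _ (zero_add 1) (by rfl)]
    have := hS.comp_extClass
    refine (congrArg (fun t => Abelian.Ext.comp _ t (zero_add 1)) this).trans ?_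
    simp
  | succ n ih =>
    intro T _ _ hT k x
    obtain ⟨G, _, _, hG, hGt, j, hj⟩ := torsion_embed I T hT
    have hS := mkSES j (LinearMap.range j).mkQ hj (Submodule.mkQ_surjective _)
      (LinearMap.exact_map_mkQ_range j)
    have : Injective (ModuleCat.of R G) := Module.injective_object_of_injective_module R G
    obtain ⟨y, hy⟩ := Abelian.Ext.covariant_sequence_exact₁ _ hS x
      (Abelian.Ext.eq_zero_of_injective _) (n₀ := n+1) rfl
    obtain ⟨l, h, hl⟩ := ih (G ⧸ LinearMap.range j) (by
      rw [eq_top_iff]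
      rintro x -
      obtain ⟨e, rfl⟩ := Submodule.mkQ_surjective _ x
      have : e ∈ gam I G := by rw [hGt]; trivial
      obtain ⟨m, hm⟩ := this
      exact ⟨m, fun a ha => by rw [← map_smul, hm a ha, map_zero]⟩) k y
    refine ⟨l, h, ?_⟩
    rw [← hy, exMap_comp, hl, Abelian.Ext.zero_comp]

/-- vanishing of Ext from `R/I^k` into modules with a partition of unity -/
lemma ext_eq_zero_of_unit {ι : Type*} [Fintype ι] (I : Ideal R) (f : ι → R) (hf : ∀ j, f j ∈ I)
    (W : Type u) [AddCommGroup W] [Module R W] (i k : ℕ) (v : ι → W →ₗ[R] W)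
    (hv : ∑ j, (f j) ^ k • v j = LinearMap.id) (x : EX I (ModuleCat.of R W) i k) : x = 0 := by
  have hx : ∀ j, (f j ^ k) • x = 0 := by
    intro j
    have h0 : (f j ^ k) • (𝟙 (ModuleCat.of R (R ⧸ I ^ k))) = 0 := by
      apply hom_ext_one
      have : f j ^ k ∈ I ^ k := Ideal.pow_mem_pow (hf j) k
      change f j ^ k • (Submodule.Quotient.mk 1 : R ⧸ I ^ k) = 0
      rw [← Submodule.Quotient.mk_smul, Submodule.Quotient.mk_eq_zero]
      simpa using this
    rw [← Abelian.Ext.mk₀_id_comp x, ← Abelian.Ext.smul_comp, ← Abelian.Ext.mk₀_smul, h0]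
    simp
  have h1 : x = x.comp (Abelian.Ext.mk₀ (∑ j, (f j) ^ k • ModuleCat.ofHom (v j))) (add_zero i) := by
    have : ∑ j, (f j) ^ k • ModuleCat.ofHom (v j) = 𝟙 (ModuleCat.of R W) := by
      ext w
      have := LinearMap.congr_fun hv w
      simpa using this
    rw [this, Abelian.Ext.comp_mk₀_id]
  rw [h1, Abelian.Ext.mk₀_sum, Abelian.Ext.comp_sum]
  refine Finset.sum_eq_zero fun j _ => ?_
  rw [Abelian.Ext.mk₀_smul, Abelian.Ext.comp_smul, ← Abelian.Ext.smul_comp, hx,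
    Abelian.Ext.zero_comp]

/-- degree zero -/
theorem lc_zero (I : Ideal R) (M : Type u) [AddCommGroup M] [Module R M] :
    Nonempty ((localCohomology I 0).obj (ModuleCat.of R M) ≃ₗ[R] gam I M) := by
  obtain ⟨ι, hι⟩ := localCohomology_isDL I 0 (ModuleCat.of R M)
  let α : ∀ k, EX I (ModuleCat.of R M) 0 k →ₗ[R] gam I M := fun k =>
    { toFun := fun x => ⟨(Abelian.Ext.linearEquiv₀ (R := R) x) (Submodule.Quotient.mk 1 : R ⧸ I ^ k),
        k, fun a ha => by
          have : a • (Submodule.Quotient.mk 1 : R ⧸ I ^ k) = 0 := by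
            rw [← Submodule.Quotient.mk_smul, Submodule.Quotient.mk_eq_zero]
            simpa using ha
          refine ((Abelian.Ext.linearEquiv₀ (R := R) x).hom.map_smul a _).symm.trans ?_
          exact (congrArg _ this).trans (map_zero _)⟩
      map_add' := fun x y => by ext; simp
      map_smul' := fun c x => by ext; simp }
  have hα : ∀ k f, (α k (Abelian.Ext.mk₀ f)).1 = f (Submodule.Quotient.mk 1 : R ⧸ I ^ k) := by
    intro k f
    obtain ⟨y, rfl⟩ := (Abelian.Ext.linearEquiv₀ (R := R)).surjective f
    simp [α]
  refine IsDL.equiv (D' := fun _ => gam I M) (t' := fun _ _ _ => LinearMap.id)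
    (ι' := fun _ => LinearMap.id) hι ⟨by simp, fun y => ⟨0, y, rfl⟩, fun k x h => ⟨k, le_rfl, h⟩⟩
    α ?_ ?_ ?_
  · intro k l h x
    obtain ⟨f, rfl⟩ := (Abelian.Ext.mk₀_bijective _ _).2 x
    ext
    rw [exMap_mk₀, hα]
    exact (hα k f).symm
  · intro k x hx
    obtain ⟨f, rfl⟩ := (Abelian.Ext.mk₀_bijective _ _).2 x
    refine ⟨k, le_rfl, ?_⟩
    have : f = 0 := by
      apply hom_ext_one
      rw [← hα, hx]; rfl
    rw [this]; simp
  · rintro k ⟨y, m, hm⟩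
    have hm' : ∀ a ∈ I ^ (max k m), a • y = 0 :=
      fun a ha => hm a (Ideal.pow_le_pow_right (le_max_right k m) ha)
    refine ⟨max k m, le_max_left _ _, Abelian.Ext.mk₀ (homOfElt (M := ModuleCat.of R M) y hm'), ?_⟩
    ext
    rw [hα, homOfElt_one]; rfl

end S3
end BassLC

namespace BassLC

section S4
open TensorProduct
variable {R : Type u} [CommRing R] {m : ℕ}

/-- product of localizations -/
abbrev LL (f : Fin m → R) : Type u := ∀ j, Localization.Away (f j)

/-- the cokernel of `R → L` -/
abbrev KK (f : Fin m → R) : Type u := LL f ⧸ LinearMap.range (Algebra.linearMap R (LL f))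

/-- `m ↦ m ⊗ 1` -/
noncomputable def mL (f : Fin m → R) (M : Type u) [AddCommGroup M] [Module R M] :
    M →ₗ[R] M ⊗[R] LL f := (TensorProduct.mk R M (LL f)).flip 1

/-- `m ⊗ l ↦ m ⊗ [l]` -/
noncomputable def mK (f : Fin m → R) (M : Type u) [AddCommGroup M] [Module R M] :
    M ⊗[R] LL f →ₗ[R] M ⊗[R] KK f := LinearMap.lTensor M (Submodule.mkQ _)

variable (f : Fin m → R) (M : Type u) [AddCommGroup M] [Module R M]

lemma mL_apply (x : M) : mL f M x = x ⊗ₜ 1 := rfl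

lemma mK_surj : Function.Surjective (mK f M) :=
  LinearMap.lTensor_surjective _ (Submodule.mkQ_surjective _)

lemma mLK_exact : Function.Exact (mL f M) (mK f M) := by
  have h := lTensor_exact M (LinearMap.exact_map_mkQ_range (Algebra.linearMap R (LL f)))
    (Submodule.mkQ_surjective _)
  intro x
  rw [show mK f M x = 0 ↔ _ from h x]
  constructor
  · rintro ⟨y, rfl⟩
    refine ⟨TensorProduct.rid R M y, ?_⟩
    have : ∀ y, mL f M (TensorProduct.rid R M y) =
        (LinearMap.lTensor M (Algebra.linearMap R (LL f))) y := by
      intro y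
      induction y with
      | zero => simp
      | add a b ha hb => simp [ha, hb]
      | tmul a b => simp [mL_apply, Algebra.algebraMap_eq_smul_one]
    exact this y
  · rintro ⟨y, rfl⟩
    exact ⟨y ⊗ₜ 1, by simp [mL_apply]⟩

instance loc_right (g : R) : IsLocalizedModule (Submonoid.powers g)
    ((TensorProduct.mk R M (Localization.Away g)).flip 1) := by
  have := IsLocalizedModule.of_linearEquiv (Submonoid.powers g)
    (TensorProduct.mk R (Localization.Away g) M 1) (TensorProduct.comm R (Localization.Away g) M)
  convert this using 1
  rfl

lemma mL_eq_zero (x : M) : mL f M x = 0 ↔ ∀ j, ∃ k : ℕ, f j ^ k • x = 0 := by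
  rw [← (TensorProduct.piRight R R M (fun j => Localization.Away (f j))).map_eq_zero_iff, funext_iff]
  refine forall_congr' fun j => ?_
  have : (TensorProduct.piRight R R M (fun j => Localization.Away (f j))) (mL f M x) j =
     ((TensorProduct.mk R M (Localization.Away (f j))).flip 1) x := by
    rw [mL_apply]; simp
  rw [this]
  change _ = 0 ↔ _
  rw [IsLocalizedModule.eq_zero_iff (Submonoid.powers (f j))]
  constructor
  · rintro ⟨⟨_, k, rfl⟩, h⟩
    exact ⟨k, h⟩
  · rintro ⟨k, h⟩
    exact ⟨⟨_, k, rfl⟩, h⟩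

lemma gam_eq_ker (I : Ideal R) (hI : Ideal.span (Set.range f) = I) :
    gam I M = LinearMap.ker (mL f M) := by
  ext x
  rw [mem_gam, LinearMap.mem_ker, mL_eq_zero]
  constructor
  · rintro ⟨k, hk⟩ j
    exact ⟨k, hk _ (Ideal.pow_mem_pow (hI ▸ Ideal.subset_span ⟨j, rfl⟩) k)⟩
  · intro h
    let J : Ideal R := LinearMap.ker (LinearMap.toSpanSingleton R M x)
    have h1 : I ≤ J.radical := by
      rw [← hI, Ideal.span_le]
      rintro _ ⟨j, rfl⟩
      obtain ⟨k, hk⟩ := h j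
      exact ⟨k, hk⟩
    have h2 : I.FG := by
      rw [← hI]
      exact ⟨(Set.finite_range f).toFinset, by simp⟩
    obtain ⟨k, hk⟩ := Ideal.exists_pow_le_of_le_radical_of_fg h1 h2
    exact ⟨k, fun a ha => hk ha⟩

lemma ext_L_zero (I : Ideal R) (hI : Ideal.span (Set.range f) = I) (i k : ℕ)
    (x : EX I (ModuleCat.of R (M ⊗[R] LL f)) i k) : x = 0 := by
  let w : Fin m → LL f := fun j => Pi.single j (IsLocalization.Away.invSelf (f j) ^ k)
  refine ext_eq_zero_of_unit I f (fun j => hI ▸ Ideal.subset_span ⟨j, rfl⟩) _ i k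
    (fun j => LinearMap.lTensor M (LinearMap.mulLeft R (w j))) ?_ x
  have h1 : ∑ j, f j ^ k • w j = 1 := by
    ext j
    rw [Finset.sum_apply, Finset.sum_eq_single j]
    · simp only [w, Pi.smul_apply, Pi.single_eq_same, Pi.one_apply]
      rw [Algebra.smul_def, map_pow, ← mul_pow, IsLocalization.Away.mul_invSelf, one_pow]
    · intro b _ hb
      simp [w, hb.symm]
    · simp
  have h2 : ∑ j, f j ^ k • LinearMap.lTensor M (LinearMap.mulLeft R (w j)) =
      LinearMap.lTensor M (LinearMap.mulLeft R (∑ j, f j ^ k • w j)) := by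
    apply TensorProduct.ext'
    intro a b
    simp only [LinearMap.sum_apply, LinearMap.smul_apply, LinearMap.lTensor_tmul,
      LinearMap.mulLeft_apply, Finset.sum_mul, tmul_sum]
    simp
  rw [h2, h1]
  ext; simp

/-- dimension shifting for local cohomology -/
theorem lc_shift [IsNoetherianRing R] (I : Ideal R) (hI : Ideal.span (Set.range f) = I) (i : ℕ) :
    Nonempty ((localCohomology I (i+1)).obj (ModuleCat.of R M) ≃ₗ[R]
      (localCohomology I i).obj (ModuleCat.of R (M ⊗[R] KK f))) := by
  have hker := gam_eq_ker f M I hI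
  -- two short exact sequences
  have hS := mkSES (gam I M).subtype (gam I M).mkQ (Submodule.injective_subtype _)
    (Submodule.mkQ_surjective _) (LinearMap.exact_subtype_mkQ _)
  let b : (M ⧸ gam I M) →ₗ[R] M ⊗[R] LL f := (gam I M).liftQ (mL f M) hker.le
  have hb : Function.Injective b := by
    rw [← LinearMap.ker_eq_bot]
    exact Submodule.ker_liftQ_eq_bot _ _ _ hker.ge
  have hbK : Function.Exact b (mK f M) := by
    intro x
    rw [mLK_exact f M x]
    constructor
    · rintro ⟨y, rfl⟩
      exact ⟨Submodule.Quotient.mk y, rfl⟩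
    · rintro ⟨y, rfl⟩
      obtain ⟨z, rfl⟩ := Submodule.mkQ_surjective _ y
      exact ⟨z, rfl⟩
  have hT := mkSES b (mK f M) hb (mK_surj f M) hbK
  obtain ⟨ι1, h1⟩ := localCohomology_isDL I (i+1) (ModuleCat.of R M)
  obtain ⟨ι2, h2⟩ := localCohomology_isDL I (i+1) (ModuleCat.of R (M ⧸ gam I M))
  obtain ⟨ι3, h3⟩ := localCohomology_isDL I i (ModuleCat.of R (M ⊗[R] KK f))
  have hgt : gam I (gam I M) = ⊤ := by
    rw [eq_top_iff]
    rintro ⟨x, k, hk⟩ -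
    exact ⟨k, fun a ha => Subtype.ext (hk a ha)⟩
  obtain ⟨e1⟩ := IsDL.equiv h1 h2
    (fun k => (Abelian.Ext.mk₀ (ModuleCat.ofHom (gam I M).mkQ)).postcompOfLinear R _ (add_zero (i+1)))
    (fun k l h x => (exMap_comp h x _ (add_zero (i+1))).symm)
    (fun k x hx => by
      obtain ⟨y, hy⟩ := Abelian.Ext.covariant_sequence_exact₂ _ hS x hx
      obtain ⟨l, h, hl⟩ := torsion_almost_zero I i (gam I M) hgt k y
      refine ⟨l, h, ?_⟩
      rw [← hy, exMap_comp, hl, Abelian.Ext.zero_comp])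
    (fun k y => by
      obtain ⟨l, h, hl⟩ := torsion_almost_zero I (i+1) (gam I M) hgt k
        (y.comp hS.extClass rfl)
      rw [exMap_comp] at hl
      obtain ⟨x, hx⟩ := Abelian.Ext.covariant_sequence_exact₃ _ hS _ rfl hl
      exact ⟨l, h, x, hx⟩)
  obtain ⟨e2⟩ := IsDL.equiv h3 h2
    (fun k => (hT.extClass).postcompOfLinear R _ rfl)
    (fun k l h x => (exMap_comp h x _ rfl).symm)
    (fun k x hx => by
      obtain ⟨y, hy⟩ := Abelian.Ext.covariant_sequence_exact₃ _ hT x rfl hx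
      refine ⟨k, le_rfl, ?_⟩
      rw [← hy, ext_L_zero f M I hI i k y, Abelian.Ext.zero_comp, map_zero])
    (fun k y => by
      obtain ⟨x, hx⟩ := Abelian.Ext.covariant_sequence_exact₁ _ hT
        (exMap I _ (i+1) k k le_rfl y) (ext_L_zero f M I hI (i+1) k _) rfl
      exact ⟨k, le_rfl, x, hx⟩)
  exact ⟨e1.trans e2.symm⟩

/-- iterated tensor powers of `K`, starting with `M` -/
noncomputable def Kc (f : Fin m → R) : ℕ → ModuleCat.{u} R
  | 0 => ModuleCat.of R R
  | i+1 => ModuleCat.of R (Kc f i ⊗[R] KK f)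

end S4
end BassLC

namespace BassLC

section S5
open TensorProduct
variable {R : Type u} [CommRing R] {m : ℕ}

theorem lc_gam_aux [IsNoetherianRing R] (f : Fin m → R) (I : Ideal R)
    (hI : Ideal.span (Set.range f) = I) (i : ℕ) : ∀ a b, a + i = b →
    Nonempty ((localCohomology I i).obj (Kc f a) ≃ₗ[R] gam I (Kc f b)) := by
  induction i with
  | zero =>
    rintro a b rfl
    exact lc_zero I (Kc f a)
  | succ i ih =>
    intro a b h
    obtain ⟨e⟩ := lc_shift f (Kc f a) I hI i
    obtain ⟨e'⟩ := ih (a+1) b (by omega)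
    exact ⟨e.trans e'⟩

theorem lc_gam [IsNoetherianRing R] (f : Fin m → R) (I : Ideal R)
    (hI : Ideal.span (Set.range f) = I) (i : ℕ) :
    Nonempty ((localCohomology I i).obj (ModuleCat.of R R) ≃ₗ[R] gam I (Kc f i)) :=
  lc_gam_aux f I hI i 0 i (zero_add i)

/-- functoriality of torsion -/
def gamMap (I : Ideal R) {M N : Type*} [AddCommGroup M] [Module R M] [AddCommGroup N] [Module R N]
    (h : M →ₗ[R] N) : gam I M →ₗ[R] gam I N :=
  h.restrict (fun x hx => by
    obtain ⟨k, hk⟩ := hx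
    exact ⟨k, fun a ha => by rw [← map_smul, hk a ha, map_zero]⟩)

lemma gamMap_coe (I : Ideal R) {M N : Type*} [AddCommGroup M] [Module R M] [AddCommGroup N]
    [Module R N] (h : M →ₗ[R] N) (x : gam I M) : (gamMap I h x : N) = h x := rfl

lemma gamMap_isLocalized [IsNoetherianRing R] (I : Ideal R) (S : Submonoid R)
    {M N : Type*} [AddCommGroup M] [Module R M] [AddCommGroup N] [Module R N]
    (h : M →ₗ[R] N) [IsLocalizedModule S h] : IsLocalizedModule S (gamMap I h) where
  map_units s := by
    have hs := (Module.End.isUnit_iff _).1 (IsLocalizedModule.map_units h s)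
    rw [Module.End.isUnit_iff]
    constructor
    · intro x y hxy
      have : s.1 • x = s.1 • y := hxy
      exact Subtype.ext (hs.1 (congrArg Subtype.val this))
    · rintro ⟨y, k, hk⟩
      obtain ⟨z, hz⟩ := hs.2 y
      have hz' : s.1 • z = y := hz
      refine ⟨⟨z, k, fun a ha => hs.1 ?_⟩, Subtype.ext hz⟩
      change s.1 • a • z = s.1 • 0
      rw [smul_comm, hz', hk a ha, smul_zero]
  surj y := by
    obtain ⟨y, k, hk⟩ := y
    obtain ⟨⟨x, s⟩, hx⟩ := IsLocalizedModule.surj S h y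
    have hx' : s.1 • y = h x := hx
    obtain ⟨t, ht⟩ := (IsNoetherian.noetherian (I ^ k) : (I ^ k).FG)
    have key : ∀ T : Finset R, (∀ a ∈ T, a ∈ I ^ k) → ∃ s' : S, ∀ a ∈ T, a • s'.1 • x = 0 := by
      classical
      intro T
      induction T using Finset.induction_on with
      | empty => intro _; exact ⟨1, by simp⟩
      | insert a T ha ih =>
        intro hT
        obtain ⟨s1, h1⟩ := ih (fun b hb => hT b (Finset.mem_insert_of_mem hb))
        have : h (a • x) = 0 := by
          rw [map_smul, ← hx', smul_comm, hk a (hT a (Finset.mem_insert_self _ _)), smul_zero]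
        rw [IsLocalizedModule.eq_zero_iff S] at this
        obtain ⟨s2, h2⟩ := this
        refine ⟨s1 * s2, fun b hb => ?_⟩
        rcases Finset.mem_insert.1 hb with rfl | hb
        · have h2' : s2.1 • b • x = 0 := h2
          rw [Submonoid.coe_mul, mul_smul, smul_comm, smul_comm b, h2', smul_zero]
        · rw [Submonoid.coe_mul, mul_comm, mul_smul, smul_comm, h1 b hb, smul_zero]
    obtain ⟨s', hs'⟩ := key t (fun a ha => ht ▸ Submodule.subset_span ha)
    refine ⟨⟨⟨s'.1 • x, k, fun a ha => ?_⟩, s' * s⟩, ?_⟩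
    · have : I ^ k ≤ LinearMap.ker (LinearMap.toSpanSingleton R M (s'.1 • x)) := by
        rw [← ht, Submodule.span_le]
        exact fun a ha => hs' a ha
      exact this ha
    · apply Subtype.ext
      change (s'.1 * s.1) • y = h (s'.1 • x)
      rw [mul_smul, hx', map_smul]
  exists_of_eq {x y} hxy := by
    have : h x.1 = h y.1 := congrArg Subtype.val hxy
    obtain ⟨c, hc⟩ := IsLocalizedModule.exists_of_eq (S := S) this
    exact ⟨c, Subtype.ext hc⟩

/-- `LocalizedModule` is functorial: the retract statement -/
theorem retract_localized [IsNoetherianRing R] (I : Ideal R) (P : Ideal R) [P.IsPrime]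
    (K : Type u) [AddCommGroup K] [Module R K]
    (R₂ : Type u) [CommRing R₂] [Algebra R R₂]
    (ρ : R₂ →ₗ[R] Localization.AtPrime P) (hρ : ρ 1 = 1) :
    ∃ (a : LocalizedModule P.primeCompl (gam I K) →ₗ[Localization.AtPrime P]
        LocalizedModule P.primeCompl (gam I (R₂ ⊗[R] K)))
      (b : LocalizedModule P.primeCompl (gam I (R₂ ⊗[R] K)) →ₗ[Localization.AtPrime P]
        LocalizedModule P.primeCompl (gam I K)), b ∘ₗ a = LinearMap.id := by
  let Q := Localization.AtPrime P
  let α : K →ₗ[R] R₂ ⊗[R] K := TensorProduct.mk R R₂ K 1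
  let β : R₂ ⊗[R] K →ₗ[R] Q ⊗[R] K := LinearMap.rTensor K ρ
  have hαβ : β ∘ₗ α = TensorProduct.mk R Q K 1 := by
    ext x
    simp [α, β, hρ]
  have hl : IsLocalizedModule P.primeCompl (β ∘ₗ α) := by
    rw [hαβ]; infer_instance
  have hl2 := gamMap_isLocalized I P.primeCompl (β ∘ₗ α)
  have hl3 : gamMap I (β ∘ₗ α) = gamMap I β ∘ₗ gamMap I α := rfl
  let a := LocalizedModule.map P.primeCompl (gamMap I α)
  let e := IsLocalizedModule.iso P.primeCompl (gamMap I (β ∘ₗ α))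
  let b0 : LocalizedModule P.primeCompl (gam I (R₂ ⊗[R] K)) →ₗ[R] gam I (Q ⊗[R] K) :=
    IsLocalizedModule.lift P.primeCompl (LocalizedModule.mkLinearMap P.primeCompl _) (gamMap I β)
      hl2.map_units
  let b1 : LocalizedModule P.primeCompl (gam I (R₂ ⊗[R] K)) →ₗ[R]
      LocalizedModule P.primeCompl (gam I K) := e.symm.toLinearMap ∘ₗ b0
  refine ⟨a, LinearMap.extendScalarsOfIsLocalization P.primeCompl Q b1, ?_⟩
  have : b1 ∘ₗ (a.restrictScalars R) = LinearMap.id := by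
    apply IsLocalizedModule.linearMap_ext P.primeCompl
      (LocalizedModule.mkLinearMap P.primeCompl _) (LocalizedModule.mkLinearMap P.primeCompl _)
    ext x : 1
    simp only [LinearMap.comp_apply, LinearMap.restrictScalars_apply, LinearMap.id_apply]
    have h1 : a (LocalizedModule.mkLinearMap P.primeCompl _ x) =
      LocalizedModule.mkLinearMap P.primeCompl _ (gamMap I α x) := by
      simp [a, LocalizedModule.map_mk]
    have h2 : b1 (LocalizedModule.mkLinearMap P.primeCompl _ (gamMap I α x)) =
        e.symm (gamMap I β (gamMap I α x)) := by
      simp only [b1, LinearMap.comp_apply, b0]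
      rw [IsLocalizedModule.lift_apply]; rfl
    rw [h1, h2, LinearEquiv.symm_apply_eq]
    exact (IsLocalizedModule.iso_mk_one P.primeCompl (gamMap I (β ∘ₗ α)) x).symm
  ext x
  exact LinearMap.congr_fun this x

end S5
end BassLC

namespace BassLC

section S6
open MvPolynomial
variable {τ : Type} {B : Type u} [CommRing B]

section defs
variable {N : Type u} [AddCommGroup N] [Module B N] [Module (MvPolynomial τ B) N]

/-- divided power differential operators in the directions of `J` -/
structure DOps (J : Finset τ) (d : τ → ℕ → N →ₗ[B] N) : Prop where
  zero : ∀ j ∈ J, ∀ n, d j 0 n = n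
  leib : ∀ j ∈ J, ∀ k n, d j (k+1) ((X j : MvPolynomial τ B) • n) =
    (X j : MvPolynomial τ B) • d j (k+1) n + d j k n
  comm : ∀ j ∈ J, ∀ l, l ≠ j → ∀ k n, d j k ((X l : MvPolynomial τ B) • n) =
    (X l : MvPolynomial τ B) • d j k n

/-- filtrations with polynomial growth -/
structure DFil (J : Finset τ) (d : τ → ℕ → N →ₗ[B] N) (F : ℕ → Submodule B N) (c : ℕ) : Prop where
  mono : Monotone F
  exh : ∀ n, ∃ s, n ∈ F s
  X_mem : ∀ l s n, n ∈ F s → (X l : MvPolynomial τ B) • n ∈ F (s+1)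
  d_mem : ∀ j ∈ J, ∀ k s n, n ∈ F s → d j k n ∈ F (s+k)
  len : ∀ s, Module.length B (F s) ≤ ((c * (s+1) ^ J.card : ℕ) : ℕ∞)

/-- holonomic-like modules -/
structure Good (J : Finset τ) (d : τ → ℕ → N →ₗ[B] N) : Prop where
  ops : DOps J d
  fil : ∃ F c, DFil J d F c

end defs

lemma len_add {N X : Type*} [AddCommGroup N] [Module B N] [AddCommGroup X] [Module B X]
    (W' W : Submodule B N) (hW : W' ≤ W) (h : N →ₗ[B] X) (E : Submodule B X)
    (hE : E ≤ W.map h) (h0 : W' ≤ LinearMap.ker h) :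
    Module.length B W' + Module.length B E ≤ Module.length B W := by
  have e : Module.length B W = Module.length B (LinearMap.ker (h.domRestrict W)) +
      Module.length B (LinearMap.range (h.domRestrict W)) :=
    Module.length_eq_add_of_exact (LinearMap.ker (h.domRestrict W)).subtype
      ((h.domRestrict W).rangeRestrict) (Submodule.injective_subtype _)
      (LinearMap.surjective_rangeRestrict _) (by
        rw [LinearMap.exact_iff, LinearMap.ker_rangeRestrict, Submodule.range_subtype])
  rw [e]
  apply add_le_add
  · refine Module.length_le_of_injective (LinearMap.codRestrict _ (Submodule.inclusion hW)
      (fun x => h0 x.2)) (fun x y hxy => ?_)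
    have := congrArg (fun t => (t.1.1 : N)) hxy
    exact Subtype.ext this
  · refine Module.length_le_of_injective (Submodule.inclusion (?_ : E ≤ _))
      (Submodule.inclusion_injective _)
    intro x hx
    obtain ⟨w, hw, rfl⟩ := hE hx
    exact ⟨⟨w, hw⟩, rfl⟩

section maps
variable {N : Type u} [AddCommGroup N] [Module B N] [Module (MvPolynomial τ B) N]
  [IsScalarTower B (MvPolynomial τ B) N]
variable {N' : Type u} [AddCommGroup N'] [Module B N'] [Module (MvPolynomial τ B) N']
  [IsScalarTower B (MvPolynomial τ B) N']
variable {J : Finset τ} {d : τ → ℕ → N →ₗ[B] N}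

lemma DOps.of_injective (h : DOps J d) {J' : Finset τ} (hJ : J' ⊆ J)
    {d' : τ → ℕ → N' →ₗ[B] N'} (φ : N' →ₗ[MvPolynomial τ B] N)
    (hφ : Function.Injective φ) (hd : ∀ j ∈ J', ∀ k n, φ (d' j k n) = d j k (φ n)) :
    DOps J' d' where
  zero j hj n := hφ (by rw [hd j hj, h.zero j (hJ hj)])
  leib j hj k n := hφ (by
    rw [hd j hj, map_smul, h.leib j (hJ hj), map_add, map_smul, hd j hj, hd j hj])
  comm j hj l hl k n := hφ (by
    rw [hd j hj, map_smul, h.comm j (hJ hj) l hl, map_smul, hd j hj])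

lemma DOps.of_surjective (h : DOps J d) {J' : Finset τ} (hJ : J' ⊆ J)
    {d' : τ → ℕ → N' →ₗ[B] N'} (φ : N →ₗ[MvPolynomial τ B] N')
    (hφ : Function.Surjective φ) (hd : ∀ j ∈ J', ∀ k n, d' j k (φ n) = φ (d j k n)) :
    DOps J' d' where
  zero j hj n := by
    obtain ⟨n, rfl⟩ := hφ n
    rw [hd j hj, h.zero j (hJ hj)]
  leib j hj k n := by
    obtain ⟨n, rfl⟩ := hφ n
    rw [← map_smul, hd j hj, h.leib j (hJ hj), map_add, map_smul, hd j hj, hd j hj]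
  comm j hj l hl k n := by
    obtain ⟨n, rfl⟩ := hφ n
    rw [← map_smul, hd j hj, h.comm j (hJ hj) l hl, map_smul, hd j hj]

/-- transport along injective maps -/
lemma DFil.comap {F : ℕ → Submodule B N} {c c' : ℕ} (h : DFil J d F c)
    {J' : Finset τ} (hJ : J' ⊆ J)
    {d' : τ → ℕ → N' →ₗ[B] N'} (φ : N' →ₗ[MvPolynomial τ B] N)
    (hd : ∀ j ∈ J', ∀ k n, φ (d' j k n) = d j k (φ n))
    (hl : ∀ s, Module.length B ((F s).comap (φ.restrictScalars B)) ≤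
      ((c' * (s+1) ^ J'.card : ℕ) : ℕ∞)) :
    DFil J' d' (fun s => (F s).comap (φ.restrictScalars B)) c' where
  mono s t hst := Submodule.comap_mono (h.mono hst)
  exh n := h.exh (φ n)
  X_mem l s n hn := by
    change φ (X l • n) ∈ F (s+1)
    rw [map_smul]
    exact h.X_mem l s _ hn
  d_mem j hj k s n hn := by
    change φ (d' j k n) ∈ F (s+k)
    rw [hd j hj]
    exact h.d_mem j (hJ hj) k s _ hn
  len := hl

lemma DFil.map {F : ℕ → Submodule B N} {c c' : ℕ} (h : DFil J d F c)
    {J' : Finset τ} (hJ : J' ⊆ J)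
    {d' : τ → ℕ → N' →ₗ[B] N'} (φ : N →ₗ[MvPolynomial τ B] N') (hφ : Function.Surjective φ)
    (hd : ∀ j ∈ J', ∀ k n, d' j k (φ n) = φ (d j k n))
    (hl : ∀ s, Module.length B ((F s).map (φ.restrictScalars B)) ≤
      ((c' * (s+1) ^ J'.card : ℕ) : ℕ∞)) :
    DFil J' d' (fun s => (F s).map (φ.restrictScalars B)) c' where
  mono s t hst := Submodule.map_mono (h.mono hst)
  exh n := by
    obtain ⟨n, rfl⟩ := hφ n
    obtain ⟨s, hs⟩ := h.exh n
    exact ⟨s, n, hs, rfl⟩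
  X_mem l s n hn := by
    obtain ⟨n, hn, rfl⟩ := hn
    exact ⟨X l • n, h.X_mem l s _ hn, map_smul φ _ _⟩
  d_mem j hj k s n hn := by
    obtain ⟨n, hn, rfl⟩ := hn
    exact ⟨d j k n, h.d_mem j (hJ hj) k s _ hn, (hd j hj k n).symm⟩
  len := hl

lemma Good.of_injective (h : Good J d) 
    {d' : τ → ℕ → N' →ₗ[B] N'} (φ : N' →ₗ[MvPolynomial τ B] N)
    (hφ : Function.Injective φ) (hd : ∀ j ∈ J, ∀ k n, φ (d' j k n) = d j k (φ n)) :
    Good J d' := by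
  obtain ⟨ho, F, c, hF⟩ := h
  refine ⟨ho.of_injective subset_rfl φ hφ hd, _, c, hF.comap subset_rfl φ hd (fun s => ?_)⟩
  refine le_trans ?_ (hF.len s)
  refine Module.length_le_of_injective ((φ.restrictScalars B).restrict (p := (F s).comap (φ.restrictScalars B)) (q := F s)
    (fun x hx => hx)) (fun x y hxy => Subtype.ext (hφ (congrArg Subtype.val hxy)))

lemma Good.of_surjective (h : Good J d) 
    {d' : τ → ℕ → N' →ₗ[B] N'} (φ : N →ₗ[MvPolynomial τ B] N')
    (hφ : Function.Surjective φ) (hd : ∀ j ∈ J, ∀ k n, d' j k (φ n) = φ (d j k n)) :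
    Good J d' := by
  obtain ⟨ho, F, c, hF⟩ := h
  refine ⟨ho.of_surjective subset_rfl φ hφ hd, _, c, hF.map subset_rfl φ hφ hd (fun s => ?_)⟩
  refine le_trans ?_ (hF.len s)
  refine Module.length_le_of_surjective ((φ.restrictScalars B).restrict (p := F s)
    (q := (F s).map (φ.restrictScalars B)) (fun x hx => ⟨x, hx, rfl⟩)) ?_
  rintro ⟨_, x, hx, rfl⟩
  exact ⟨⟨x, hx⟩, rfl⟩

lemma exists_sub_ops (φ : N' →ₗ[B] N) (hφ : Function.Injective φ)
    (J : Finset τ) (h : ∀ j ∈ J, ∀ k n, ∃ n', φ n' = d j k (φ n)) :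
    ∃ d' : τ → ℕ → N' →ₗ[B] N', ∀ j ∈ J, ∀ k n, φ (d' j k n) = d j k (φ n) := by
  classical
  have : ∀ j k, ∃ d' : N' →ₗ[B] N', j ∈ J → ∀ n, φ (d' n) = d j k (φ n) := by
    intro j k
    by_cases hj : j ∈ J
    · choose g hg using h j hj k
      refine ⟨{ toFun := g, map_add' := ?_, map_smul' := ?_ }, fun _ => hg⟩
      · intro x y
        apply hφ
        simp [hg]
      · intro x y
        apply hφ
        simp [hg]
    · exact ⟨0, fun h => absurd h hj⟩
  choose d' hd' using this
  exact ⟨d', fun j hj k => hd' j k hj⟩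

lemma exists_quot_ops (φ : N →ₗ[B] N') (hφ : Function.Surjective φ)
    (J : Finset τ) (h : ∀ j ∈ J, ∀ k n, φ n = 0 → φ (d j k n) = 0) :
    ∃ d' : τ → ℕ → N' →ₗ[B] N', ∀ j ∈ J, ∀ k n, d' j k (φ n) = φ (d j k n) := by
  classical
  have : ∀ j k, ∃ d' : N' →ₗ[B] N', j ∈ J → ∀ n, d' (φ n) = φ (d j k n) := by
    intro j k
    by_cases hj : j ∈ J
    · have hw : ∀ x y, φ x = φ y → φ (d j k x) = φ (d j k y) := by
        intro x y hxy
        rw [← sub_eq_zero, ← map_sub, ← map_sub]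
        apply h j hj
        rw [map_sub, hxy, sub_self]
      choose σ hσ using hφ
      refine ⟨{ toFun := fun x => φ (d j k (σ x)), map_add' := ?_, map_smul' := ?_ }, fun _ n => ?_⟩
      · intro x y
        rw [← map_add, ← map_add]
        apply hw
        simp [hσ]
      · intro x y
        simp only [RingHom.id_apply]
        rw [← map_smul, ← map_smul]
        apply hw
        simp [hσ]
      · exact hw _ _ (hσ _)
    · exact ⟨0, fun h => absurd h hj⟩
  choose d' hd' using this
  exact ⟨d', fun j hj k => hd' j k hj⟩

end maps

lemma growth {x : ℕ∞} {s c e : ℕ} (h : ((s + 1 : ℕ) : ℕ∞) * x ≤ ((c * (s + s + 1) ^ (e+1) : ℕ) : ℕ∞)) :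
    x ≤ ((c * 2 ^ (e+1) * (s+1) ^ e : ℕ) : ℕ∞) := by
  have hx : x ≠ ⊤ := by
    rintro rfl
    rw [ENat.mul_top (by simp)] at h
    exact absurd (top_le_iff.1 h) (ENat.natCast_ne_top _)
  lift x to ℕ using hx
  norm_cast at h ⊢
  have h2 : c * (s + s + 1) ^ (e+1) ≤ c * (2 * (s+1)) ^ (e+1) := by gcongr; omega
  have h3 : (s+1) * x ≤ (s+1) * (c * 2 ^ (e+1) * (s+1) ^ e) := by
    refine (h.trans h2).trans (le_of_eq ?_)
    rw [mul_pow]; ring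
  exact Nat.le_of_mul_le_mul_left h3 (Nat.succ_pos s)

section step
variable {N : Type u} [AddCommGroup N] [Module B N] [Module (MvPolynomial τ B) N]
  [IsScalarTower B (MvPolynomial τ B) N]
variable {J : Finset τ} {d : τ → ℕ → N →ₗ[B] N} [DecidableEq τ]

variable (N) in
/-- multiplication by `X_j - a` -/
noncomputable def yy (j : τ) (a : B) : N →ₗ[MvPolynomial τ B] N :=
  LinearMap.lsmul _ N (X j - C a)

lemma yy_apply (j : τ) (a : B) (n : N) :
    yy N j a n = (X j : MvPolynomial τ B) • n - a • n := by
  change (X j - C a : MvPolynomial τ B) • n = _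
  rw [sub_smul, ← algebraMap_eq, algebraMap_smul]

lemma DOps.yy_succ (h : DOps J d) {j : τ} (hj : j ∈ J) (a : B) (k : ℕ) (n : N) :
    d j (k+1) (yy N j a n) = yy N j a (d j (k+1) n) + d j k n := by
  rw [yy_apply, yy_apply, map_sub, map_smul (d j (k+1)) a n, h.leib j hj]
  abel

lemma DOps.yy_comm (h : DOps J d) {j l : τ} (hl : l ∈ J) (hlj : j ≠ l) (a : B) (k : ℕ) (n : N) :
    d l k (yy N j a n) = yy N j a (d l k n) := by
  rw [yy_apply, yy_apply, map_sub, map_smul (d l k) a n, h.comm l hl j hlj]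

lemma DFil.yy_mem {F : ℕ → Submodule B N} {c : ℕ} (h : DFil J d F c) (j : τ) (a : B) (s : ℕ) (n : N)
    (hn : n ∈ F s) : yy N j a n ∈ F (s+1) := by
  rw [yy_apply]
  exact (F (s+1)).sub_mem (h.X_mem j s n hn)
    ((F (s+1)).smul_mem a (h.mono (Nat.le_succ s) hn))

lemma DFil.yy_pow_mem {F : ℕ → Submodule B N} {c : ℕ} (h : DFil J d F c) (j : τ) (a : B) (i : ℕ) :
    ∀ (s : ℕ) (n : N), n ∈ F s → (yy N j a ^ i) n ∈ F (s+i) := by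
  induction i with
  | zero => intro s n hn; simpa using hn
  | succ i ih =>
    intro s n hn
    rw [pow_succ']
    exact h.yy_mem j a _ _ (ih s n hn)

/-- kernel step -/
theorem Good.ker (h : Good J d) {j : τ} (hj : j ∈ J) (a : B) :
    ∃ d' : τ → ℕ → LinearMap.ker (yy N j a) →ₗ[B] LinearMap.ker (yy N j a),
      Good (J.erase j) d' := by
  obtain ⟨ho, F, c, hF⟩ := h
  let φ := (LinearMap.ker (yy N j a)).subtype
  have hφ : Function.Injective φ := Submodule.injective_subtype _
  obtain ⟨d', hd'⟩ := exists_sub_ops (d := d) (φ.restrictScalars B) hφ (J.erase j) (by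
    rintro l hl k ⟨n, hn⟩
    refine ⟨⟨d l k n, ?_⟩, rfl⟩
    rw [LinearMap.mem_ker] at hn ⊢
    rw [← ho.yy_comm (Finset.mem_of_mem_erase hl) (Finset.ne_of_mem_erase hl).symm, hn, map_zero])
  refine ⟨d', ho.of_injective (Finset.erase_subset _ _) φ hφ hd', _, c * 2 ^ ((J.erase j).card+1),
    hF.comap (Finset.erase_subset _ _) φ hd' (fun s => growth ?_)⟩
  rw [Finset.card_erase_add_one hj]
  refine le_trans ?_ (hF.len (s+s))
  -- the submodule of `F s` killed by `y`
  let E : Submodule B N := F s ⊓ (LinearMap.ker (yy N j a)).restrictScalars B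
  have hE : Module.length B ((F s).comap (φ.restrictScalars B)) ≤ Module.length B E := by
    refine Module.length_le_of_injective ((φ.restrictScalars B).restrict
      (p := (F s).comap (φ.restrictScalars B)) (q := E) (fun x hx => ⟨hx, x.2⟩))
      (fun x y hxy => Subtype.ext (Subtype.ext (congrArg (fun t => (t.1 : N)) hxy)))
  have hEy : ∀ n ∈ E, yy N j a n = 0 := fun n hn => hn.2
  have hdy : ∀ n ∈ E, ∀ k, yy N j a (d j (k+1) n) = - d j k n := by
    intro n hn k
    have := ho.yy_succ hj a k n
    rw [hEy n hn, map_zero] at this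
    exact eq_neg_of_add_eq_zero_left this.symm
  let V : ℕ → Submodule B N := fun m => ⨆ k : Fin m, E.map (d j k)
  have hV : ∀ m, V m ≤ V (m+1) := fun m => iSup_le fun k =>
    le_iSup (fun k : Fin (m+1) => E.map (d j k)) (Fin.castSucc k)
  have hpow : ∀ m k, ∀ n ∈ E, (yy N j a ^ (m + k)) (d j k n) = (-1 : ℤ) ^ k • (yy N j a ^ m) n := by
    intro m k
    induction k with
    | zero => intro n hn; simp [ho.zero j hj]
    | succ k ih =>
      intro n hn
      rw [← add_assoc, pow_succ, Module.End.mul_apply, hdy n hn, map_neg, ih n hn, pow_succ]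
      simp
  have hpow0 : ∀ m, 0 < m → ∀ n ∈ E, (yy N j a ^ m) n = 0 := by
    intro m hm n hn
    obtain ⟨m, rfl⟩ : ∃ m', m = m' + 1 := ⟨m - 1, by omega⟩
    rw [pow_succ, Module.End.mul_apply, hEy n hn, map_zero]
  have hlen : ∀ m, ((m : ℕ) : ℕ∞) * Module.length B E ≤ Module.length B (V m) := by
    intro m
    induction m with
    | zero => simp
    | succ m ih =>
      rw [Nat.cast_add, add_mul, Nat.cast_one, one_mul]
      refine (add_le_add_left ih _).trans ?_
      refine len_add (V m) (V (m+1)) (hV m) ((yy N j a ^ m).restrictScalars B) E ?_ ?_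
      · intro n hn
        refine ⟨(-1 : ℤ) ^ m • d j m n, ?_, ?_⟩
        · refine zsmul_mem ?_ _
          exact (le_iSup (fun k : Fin (m+1) => E.map (d j k)) (Fin.last m)) ⟨n, hn, rfl⟩
        · have := hpow 0 m n hn
          rw [zero_add] at this
          simp only [LinearMap.coe_restrictScalars, map_zsmul]
          rw [this]
          simp [smul_smul, ← mul_pow]
      · refine iSup_le fun k => ?_
        rintro _ ⟨n, hn, rfl⟩
        have hk : (m - k) + k = m := by omega
        have := hpow (m - k) k n hn
        rw [hk, hpow0 (m-k) (by omega) n hn] at this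
        simpa using this
  calc _ ≤ ((s + 1 : ℕ) : ℕ∞) * Module.length B E := by gcongr
    _ ≤ _ := hlen (s+1)
    _ ≤ _ := by
      refine Module.length_le_of_injective (Submodule.inclusion (iSup_le fun k => ?_))
        (Submodule.inclusion_injective _)
      rintro _ ⟨n, hn, rfl⟩
      exact hF.mono (by omega) (hF.d_mem j hj k s n hn.1)

/-- cokernel step -/
theorem Good.coker (h : Good J d) {j : τ} (hj : j ∈ J) (a : B) :
    ∃ d' : τ → ℕ → (N ⧸ LinearMap.range (yy N j a)) →ₗ[B] (N ⧸ LinearMap.range (yy N j a)),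
      Good (J.erase j) d' := by
  obtain ⟨ho, F, c, hF⟩ := h
  let φ := (LinearMap.range (yy N j a)).mkQ
  have hφ : Function.Surjective φ := Submodule.mkQ_surjective _
  have hφy : ∀ n, φ (yy N j a n) = 0 := fun n => by
    simp [φ]
  obtain ⟨d', hd'⟩ := exists_quot_ops (d := d) (φ.restrictScalars B) hφ (J.erase j) (by
    intro l hl k n hn
    have : n ∈ LinearMap.range (yy N j a) := (Submodule.Quotient.mk_eq_zero _).1 hn
    obtain ⟨n, rfl⟩ := this
    rw [ho.yy_comm (Finset.mem_of_mem_erase hl) (Finset.ne_of_mem_erase hl).symm]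
    exact hφy _)
  refine ⟨d', ho.of_surjective (Finset.erase_subset _ _) φ hφ hd', _, c * 2 ^ ((J.erase j).card+1),
    hF.map (Finset.erase_subset _ _) φ hφ hd' (fun s => growth ?_)⟩
  rw [Finset.card_erase_add_one hj]
  refine le_trans ?_ (hF.len (s+s))
  let E := (F s).map (φ.restrictScalars B)
  -- `d_k y^i ≡ d_{k-i}` modulo `y`
  have h1 : ∀ i k n, φ (d j (k + i) ((yy N j a ^ i) n)) = φ (d j k n) := by
    intro i
    induction i with
    | zero => intro k n; simp
    | succ i ih =>
      intro k n
      rw [pow_succ', Module.End.mul_apply, ← add_assoc, ho.yy_succ hj, map_add, hφy, zero_add, ih]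
  have h2 : ∀ i k n, φ (d j k ((yy N j a ^ (i + 1 + k)) n)) = 0 := by
    intro i k n
    rw [add_comm, pow_add, Module.End.mul_apply]
    have := h1 k 0 ((yy N j a ^ (i+1)) n)
    rw [zero_add] at this
    rw [this, ho.zero j hj, pow_succ', Module.End.mul_apply, hφy]
  -- W m = sum of y^i F_s, s+1-m ≤ i ≤ s
  let W : ℕ → Submodule B N := fun m => ⨆ i : Fin m, (F s).map ((yy N j a ^ (s - i : ℕ)).restrictScalars B)
  have hW : ∀ m, W m ≤ W (m+1) := fun m => iSup_le fun k =>
    le_iSup (fun i : Fin (m+1) => (F s).map ((yy N j a ^ (s - i : ℕ)).restrictScalars B)) (Fin.castSucc k)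
  have hlen : ∀ m, m ≤ s + 1 → ((m : ℕ) : ℕ∞) * Module.length B E ≤ Module.length B (W m) := by
    intro m
    induction m with
    | zero => simp
    | succ m ih =>
      intro hm
      rw [Nat.cast_add, add_mul, Nat.cast_one, one_mul]
      refine (add_le_add_left (ih (by omega)) _).trans ?_
      refine len_add (W m) (W (m+1)) (hW m) ((φ.restrictScalars B) ∘ₗ d j (s - m)) E ?_ ?_
      · rintro _ ⟨n, hn, rfl⟩
        refine ⟨(yy N j a ^ (s - m)) n, ?_, ?_⟩
        · exact (le_iSup (fun i : Fin (m+1) => (F s).map ((yy N j a ^ (s - i : ℕ)).restrictScalars B))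
            (Fin.last m)) ⟨n, hn, rfl⟩
        · have := h1 (s - m) 0 n
          rw [zero_add, ho.zero j hj] at this
          exact this
      · refine iSup_le fun k => ?_
        rintro _ ⟨n, hn, rfl⟩
        have e : s - (k : ℕ) = (m - 1 - k) + 1 + (s - m) := by omega
        rw [e]
        exact h2 _ _ n
  calc _ ≤ _ := hlen (s+1) le_rfl
    _ ≤ _ := by
      refine Module.length_le_of_injective (Submodule.inclusion (iSup_le fun k => ?_))
        (Submodule.inclusion_injective _)
      rintro _ ⟨n, hn, rfl⟩
      exact hF.mono (by omega) (hF.yy_pow_mem j a _ s n hn)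

end step

end S6
end BassLC

namespace BassLC

section S7
open MvPolynomial
variable {τ : Type} {B : Type u} [CommRing B]

section prod
variable {m : ℕ} {N : Fin m → Type u} [∀ i, AddCommGroup (N i)] [∀ i, Module B (N i)]
  [∀ i, Module (MvPolynomial τ B) (N i)]
  [∀ i, IsScalarTower B (MvPolynomial τ B) (N i)]

/-- operators on products -/
def piOps (d : ∀ i, τ → ℕ → N i →ₗ[B] N i) : τ → ℕ → (∀ i, N i) →ₗ[B] (∀ i, N i) :=
  fun j k => LinearMap.pi (fun i => d i j k ∘ₗ LinearMap.proj i)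

theorem Good.pi {J : Finset τ} {d : ∀ i, τ → ℕ → N i →ₗ[B] N i} (h : ∀ i, Good J (d i)) :
    Good J (piOps d) := by
  refine ⟨⟨?_, ?_, ?_⟩, ?_⟩
  · intro j hj n; ext i; exact (h i).ops.zero j hj (n i)
  · intro j hj k n; ext i; exact (h i).ops.leib j hj k (n i)
  · intro j hj l hl k n; ext i; exact (h i).ops.comm j hj l hl k (n i)
  · choose F c hF using fun i => (h i).fil
    refine ⟨fun s => Submodule.pi Set.univ (fun i => F i s), ∑ i, c i, ?_, ?_, ?_, ?_, ?_⟩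
    · intro s t hst n hn i hi
      exact (hF i).mono hst (hn i hi)
    · intro n
      choose s hs using fun i => (hF i).exh (n i)
      exact ⟨Finset.univ.sup s, fun i _ => (hF i).mono (Finset.le_sup (Finset.mem_univ i)) (hs i)⟩
    · intro l s n hn i hi
      exact (hF i).X_mem l s _ (hn i hi)
    · intro j hj k s n hn i hi
      exact (hF i).d_mem j hj k s _ (hn i hi)
    · intro s
      have : Module.length B (Submodule.pi Set.univ (fun i => F i s)) ≤
          Module.length B (∀ i, F i s) := by
        refine Module.length_le_of_injective (LinearMap.pi (fun i =>
          (LinearMap.proj i).restrict (p := Submodule.pi Set.univ (fun i => F i s)) (q := F i s)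
          (fun x hx => hx i trivial))) ?_
        intro x y hxy
        ext i
        exact congrArg Subtype.val (congrFun hxy i)
      refine this.trans ?_
      rw [Module.length_pi_of_fintype]
      refine (Finset.sum_le_sum fun i _ => (hF i).len s).trans (le_of_eq ?_)
      rw [Finset.sum_mul]
      push_cast
      rfl

end prod

section base
variable {N : Type u} [AddCommGroup N] [Module B N] [Module (MvPolynomial τ B) N]
  [IsScalarTower B (MvPolynomial τ B) N]

theorem Good.finite {d : τ → ℕ → N →ₗ[B] N} (h : Good ∅ d) : Module.Finite B N := by
  obtain ⟨-, F, c, hF⟩ := h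
  have hl : ∀ s, Module.length B (F s) ≤ (c : ℕ∞) := fun s => by simpa using hF.len s
  have hfin : ∀ s, IsFiniteLength B (F s) := fun s =>
    Module.length_ne_top_iff.1 (ne_top_of_le_ne_top (ENat.natCast_ne_top c) (hl s))
  have hAN : ∀ s, IsNoetherian B (F s) ∧ IsArtinian B (F s) := fun s =>
    isFiniteLength_iff_isNoetherian_isArtinian.1 (hfin s)
  -- choose s with maximal length
  let len : ℕ → ℕ := fun s => (Module.length B (F s)).toNat
  have hlen : ∀ s, (len s : ℕ∞) = Module.length B (F s) := fun s =>
    ENat.coe_toNat (ne_top_of_le_ne_top (ENat.natCast_ne_top c) (hl s))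
  have hb : ∀ s, len s ≤ c := fun s => by
    have := hl s
    rw [← hlen] at this
    exact_mod_cast this
  obtain ⟨s, hs⟩ : ∃ s, ∀ t, len t ≤ len s := by
    have hne : (Set.range len).Nonempty := ⟨_, 0, rfl⟩
    have hbd : BddAbove (Set.range len) := ⟨c, by rintro _ ⟨t, rfl⟩; exact hb t⟩
    obtain ⟨s, hs⟩ := Nat.sSup_mem hne hbd
    exact ⟨s, fun t => hs ▸ le_csSup hbd ⟨t, rfl⟩⟩
  have htop : F s = ⊤ := by
    rw [eq_top_iff]
    rintro n -
    obtain ⟨t, ht⟩ := hF.exh n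
    by_contra hn
    have hst : F s ≤ F (max s t) := hF.mono (le_max_left _ _)
    have hn' : n ∈ F (max s t) := hF.mono (le_max_right _ _) ht
    let G : Submodule B (F (max s t)) := (F s).comap (F (max s t)).subtype
    have hG : G ≠ ⊤ := by
      intro h
      have : (⟨n, hn'⟩ : F (max s t)) ∈ G := by rw [h]; trivial
      exact hn this
    have := (hAN (max s t)).1
    have := (hAN (max s t)).2
    have h1 := Submodule.length_lt hG
    have h2 : Module.length B G = Module.length B (F s) :=
      (Submodule.comapSubtypeEquivOfLe hst).length_eq
    rw [h2, ← hlen, ← hlen] at h1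
    have h3 := hs (max s t)
    have : len s < len (max s t) := by exact_mod_cast h1
    omega
  have := (hAN s).1
  have hf : Module.Finite B (F s) := inferInstance
  rw [htop] at hf
  exact Module.Finite.equiv (Submodule.topEquiv (R := B) (M := N))

end base

section taylor
variable [DecidableEq τ]

variable (B) in
/-- Taylor expansion in direction `j` -/
noncomputable def tay (j : τ) : MvPolynomial τ B →ₐ[B] Polynomial (MvPolynomial τ B) :=
  aeval (fun l => Polynomial.C (X l) + if l = j then Polynomial.X else 0)

lemma tay_X_self (j : τ) : tay B j (X j) = Polynomial.C (X j) + Polynomial.X := by simp [tay]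

lemma tay_X_ne {j l : τ} (h : l ≠ j) : tay B j (X l) = Polynomial.C (X l) := by simp [tay, h]

lemma tay_C (j : τ) (b : B) : tay B j (C b) = Polynomial.C (C b) := by
  rw [← algebraMap_eq, AlgHom.commutes]; rfl

lemma tay_coeff_zero (j : τ) (p : MvPolynomial τ B) : (tay B j p).coeff 0 = p := by
  induction p using MvPolynomial.induction_on with
  | C b => simp [tay_C]
  | add p q hp hq => simp [hp, hq]
  | mul_X p l hp =>
    rw [map_mul, Polynomial.mul_coeff_zero, hp]
    by_cases h : l = j
    · subst h; simp [tay_X_self]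
    · simp [tay_X_ne h]

/-- coefficients of the Taylor expansion -/
noncomputable def DD : τ → ℕ → MvPolynomial τ B →ₗ[B] MvPolynomial τ B := fun j k =>
  ((Polynomial.lcoeff (MvPolynomial τ B) k).restrictScalars B) ∘ₗ (tay B j).toLinearMap

lemma DD_apply (j : τ) (k : ℕ) (p : MvPolynomial τ B) : DD j k p = (tay B j p).coeff k := rfl

lemma DD_ops (J : Finset τ) : DOps (B := B) J (DD (τ := τ) (B := B)) where
  zero j _ p := tay_coeff_zero j p
  leib j _ k p := by
    simp only [DD_apply, smul_eq_mul, map_mul, tay_X_self, add_mul, Polynomial.coeff_add,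
      Polynomial.coeff_C_mul, Polynomial.coeff_X_mul]
  comm j _ l hl k p := by
    simp only [DD_apply, smul_eq_mul, map_mul, tay_X_ne hl, Polynomial.coeff_C_mul]

variable (τ B) in
/-- the degree one piece -/
noncomputable def MM : Submodule B (MvPolynomial τ B) := Submodule.span B (insert 1 (Set.range X))

lemma one_mem_MM : (1 : MvPolynomial τ B) ∈ MM τ B := Submodule.subset_span (Set.mem_insert _ _)

lemma X_mem_MM (l : τ) : (X l : MvPolynomial τ B) ∈ MM τ B :=
  Submodule.subset_span (Set.mem_insert_of_mem _ ⟨l, rfl⟩)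

lemma MM_mono : Monotone (fun s => (MM τ B) ^ s) :=
  pow_right_monotone (Submodule.one_le.2 one_mem_MM)

lemma MM_exh (p : MvPolynomial τ B) : ∃ s, p ∈ (MM τ B) ^ s := by
  induction p using MvPolynomial.induction_on with
  | C b =>
    refine ⟨0, ?_⟩
    rw [pow_zero]
    exact Submodule.mem_one.2 ⟨b, rfl⟩
  | add p q hp hq =>
    obtain ⟨s, hs⟩ := hp
    obtain ⟨t, ht⟩ := hq
    exact ⟨max s t, Submodule.add_mem _ (MM_mono (le_max_left s t) hs)
      (MM_mono (le_max_right s t) ht)⟩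
  | mul_X p l hp =>
    obtain ⟨s, hs⟩ := hp
    exact ⟨s+1, by rw [pow_succ]; exact Submodule.mul_mem_mul hs (X_mem_MM l)⟩

/-- induction principle for filtered pieces -/
lemma MM_pow_smul {N : Type u} [AddCommGroup N] [Module B N] [Module (MvPolynomial τ B) N]
    [IsScalarTower B (MvPolynomial τ B) N] {J : Finset τ} {d : τ → ℕ → N →ₗ[B] N}
    {F : ℕ → Submodule B N} {c : ℕ} (hF : DFil J d F c) (δ : ℕ) :
    ∀ p ∈ (MM τ B) ^ δ, ∀ s n, n ∈ F s → p • n ∈ F (s + δ) := by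
  induction δ with
  | zero =>
    intro p hp s n hn
    rw [pow_zero] at hp
    obtain ⟨b, rfl⟩ := Submodule.mem_one.1 hp
    rw [algebraMap_smul]
    exact (F s).smul_mem b hn
  | succ δ ih =>
    intro p hp s n hn
    rw [pow_succ] at hp
    induction hp using Submodule.mul_induction_on' with
    | add x _ y _ hx hy =>
      rw [add_smul]
      exact Submodule.add_mem _ hx hy
    | mem_mul_mem q hq x hx =>
      rw [mul_smul]
      have key : x • n ∈ F (s+1) := by
        induction hx using Submodule.span_induction with
        | mem x hx =>
          rcases hx with rfl | ⟨l, rfl⟩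
          · rw [one_smul]; exact hF.mono (Nat.le_succ s) hn
          · exact hF.X_mem l s n hn
        | zero => simp
        | add x y _ _ hx hy => rw [add_smul]; exact Submodule.add_mem _ hx hy
        | smul b x _ hx => rw [smul_assoc]; exact Submodule.smul_mem _ b hx
      have := ih q hq (s+1) _ key
      rwa [add_right_comm] at this

lemma DD_mem (j : τ) (s : ℕ) : ∀ k, ∀ p ∈ (MM τ B) ^ s, DD j k p ∈ (MM τ B) ^ s := by
  have ho := DD_ops (B := B) ({j} : Finset τ)
  have hj : j ∈ ({j} : Finset τ) := Finset.mem_singleton_self j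
  induction s with
  | zero =>
    intro k p hp
    rw [pow_zero] at hp ⊢
    obtain ⟨b, rfl⟩ := Submodule.mem_one.1 hp
    rw [DD_apply, algebraMap_eq, tay_C, Polynomial.coeff_C]
    split_ifs
    · exact Submodule.mem_one.2 ⟨b, rfl⟩
    · exact Submodule.zero_mem _
  | succ s ih =>
    intro k p hp
    rw [pow_succ'] at hp
    induction hp using Submodule.mul_induction_on' with
    | add x _ y _ hx hy =>
      rw [map_add]
      exact Submodule.add_mem _ hx hy
    | mem_mul_mem x hx q hq =>
      induction hx using Submodule.span_induction with
      | mem x hx =>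
        rcases hx with rfl | ⟨l, rfl⟩
        · rw [one_mul]; exact MM_mono (Nat.le_succ s) (ih k q hq)
        · have hX : ∀ r ∈ (MM τ B) ^ s, X l * r ∈ (MM τ B) ^ (s+1) := fun r hr => by
            rw [pow_succ']; exact Submodule.mul_mem_mul (X_mem_MM l) hr
          by_cases h : l = j
          · subst h
            cases k with
            | zero =>
              have : DD l 0 (X l * q) = X l * q := ho.zero l hj (X l * q)
              rw [this]; exact hX q hq
            | succ k =>
              have : DD l (k+1) (X l * q) = X l * DD l (k+1) q + DD l k q := ho.leib l hj k q
              rw [this]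
              exact Submodule.add_mem _ (hX _ (ih _ q hq)) (MM_mono (Nat.le_succ s) (ih k q hq))
          · have : DD j k (X l * q) = X l * DD j k q := ho.comm j hj l h k q
            rw [this]
            exact hX _ (ih _ q hq)
      | zero => simp
      | add x y _ _ hx hy => rw [add_mul, map_add]; exact Submodule.add_mem _ hx hy
      | smul b x _ hx => rw [smul_mul_assoc, map_smul]; exact Submodule.smul_mem _ b hx

lemma MM_totalDegree (s : ℕ) : ∀ p ∈ (MM τ B) ^ s, p.totalDegree ≤ s := by
  induction s with
  | zero =>
    intro p hp
    rw [pow_zero] at hp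
    obtain ⟨b, rfl⟩ := Submodule.mem_one.1 hp
    simp [algebraMap_eq]
  | succ s ih =>
    intro p hp
    rw [pow_succ'] at hp
    induction hp using Submodule.mul_induction_on' with
    | add x _ y _ hx hy => exact (totalDegree_add x y).trans (max_le hx hy)
    | mem_mul_mem x hx q hq =>
      refine (totalDegree_mul x q).trans ?_
      have : x.totalDegree ≤ 1 := by
        induction hx using Submodule.span_induction with
        | mem x hx =>
          rcases hx with rfl | ⟨l, rfl⟩
          · simp
          · refine (totalDegree_monomial_le _ _).trans ?_
            simp
        | zero => simp
        | add x y _ _ hx hy => exact (totalDegree_add x y).trans (max_le hx hy)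
        | smul b x _ hx => exact (totalDegree_smul_le b x).trans hx
      have := ih q hq
      omega

theorem Good.poly [Fintype τ] [IsArtinianRing B] :
    Good (Finset.univ : Finset τ) (DD (τ := τ) (B := B)) := by
  have hB : Module.length B B ≠ ⊤ := Module.length_ne_top
  refine ⟨DD_ops _, fun s => (MM τ B) ^ s, (Module.length B B).toNat, MM_mono, MM_exh, ?_, ?_, ?_⟩
  · intro l s n hn
    rw [smul_eq_mul, pow_succ']
    exact Submodule.mul_mem_mul (X_mem_MM l) hn
  · intro j _ k s n hn
    exact MM_mono (Nat.le_add_right s k) (DD_mem j s k n hn)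
  · intro s
    let e : (τ → Fin (s+1)) → (τ →₀ ℕ) := fun v => Finsupp.equivFunOnFinite.symm (fun i => (v i : ℕ))
    let ψ : ((MM τ B) ^ s : Submodule B (MvPolynomial τ B)) →ₗ[B] ((τ → Fin (s+1)) → B) :=
      (LinearMap.pi (fun v => lcoeff B (e v))) ∘ₗ Submodule.subtype _
    have hψ : Function.Injective ψ := by
      rw [← LinearMap.ker_eq_bot, LinearMap.ker_eq_bot']
      rintro ⟨p, hp⟩ h
      ext v
      by_contra hv
      have hdeg : ∀ i, v i ≤ s := by
        intro i
        have h1 := le_totalDegree (p := p) (mem_support_iff.2 hv)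
        have h2 : v i ≤ v.sum fun _ e => e := by
          by_cases hi : i ∈ v.support
          · exact Finset.single_le_sum (f := fun i => v i) (fun _ _ => Nat.zero_le _) hi
          · rw [Finsupp.notMem_support_iff.1 hi]; exact Nat.zero_le _
        exact h2.trans (h1.trans (MM_totalDegree s p hp))
      have h3 := congrFun h (fun i => ⟨v i, Nat.lt_succ_of_le (hdeg i)⟩)
      have h4 : e (fun i => ⟨v i, Nat.lt_succ_of_le (hdeg i)⟩) = v := by
        ext i; simp [e]
      apply hv
      have h5 : coeff (e (fun i => ⟨v i, Nat.lt_succ_of_le (hdeg i)⟩)) p = 0 := h3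
      rw [h4] at h5
      exact h5
    refine (Module.length_le_of_injective ψ hψ).trans ?_
    rw [Module.length_pi_of_fintype]
    simp only [Finset.sum_const, Finset.card_univ, Fintype.card_fun, Fintype.card_fin]
    rw [nsmul_eq_mul, Nat.cast_mul, ENat.coe_toNat hB, mul_comm]

end taylor

end S7
end BassLC

namespace BassLC

section S8
open MvPolynomial
variable {τ : Type} {B : Type u} [CommRing B] [DecidableEq τ]

/-- sequences with the Taylor-twisted module structure -/
@[ext] structure Tw (_j : τ) (N : Type u) : Type u where
  /-- coefficients -/
  co : ℕ → N

section tw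
variable {N : Type u} [AddCommGroup N] [Module (MvPolynomial τ B) N] (j : τ)

/-- underlying functions -/
def twEquiv (j : τ) (N : Type u) : Tw j N ≃ (ℕ → N) := ⟨Tw.co, Tw.mk, fun _ => rfl, fun _ => rfl⟩

noncomputable instance : AddCommGroup (Tw j N) := (twEquiv j N).addCommGroup

lemma tw_add (u v : Tw j N) (k : ℕ) : (u + v).co k = u.co k + v.co k := rfl
lemma tw_zero (k : ℕ) : (0 : Tw j N).co k = 0 := rfl

lemma DD_mul (k : ℕ) (p q : MvPolynomial τ B) :
    DD j k (p * q) = ∑ x ∈ Finset.HasAntidiagonal.antidiagonal k, DD j x.1 p * DD j x.2 q := by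
  simp only [DD_apply, map_mul, Polynomial.coeff_mul]

lemma DD_one (k : ℕ) : DD j k (1 : MvPolynomial τ B) = if k = 0 then 1 else 0 := by
  simp only [DD_apply, map_one, Polynomial.coeff_one]

lemma DD_C (k : ℕ) (b : B) : DD j k (C b : MvPolynomial τ B) = if k = 0 then C b else 0 := by
  simp only [DD_apply, tay_C, Polynomial.coeff_C]

lemma DD_zero' (p : MvPolynomial τ B) : DD j 0 p = p := tay_coeff_zero j p

noncomputable instance twSMul : SMul (MvPolynomial τ B) (Tw j N) where
  smul p u := ⟨fun k => ∑ x ∈ Finset.HasAntidiagonal.antidiagonal k, DD j x.1 p • u.co x.2⟩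

lemma tw_smul (p : MvPolynomial τ B) (u : Tw j N) (k : ℕ) :
    (p • u).co k = ∑ x ∈ Finset.HasAntidiagonal.antidiagonal k, DD j x.1 p • u.co x.2 := rfl

lemma sum_anti_ite (k : ℕ) (g : ℕ → N) (c : MvPolynomial τ B) :
    ∑ x ∈ Finset.HasAntidiagonal.antidiagonal k, (if x.1 = 0 then c else 0) • g x.2 = c • g k := by
  rw [Finset.sum_eq_single (0, k)]
  · simp
  · rintro ⟨a, b⟩ h hne
    rw [Finset.HasAntidiagonal.mem_antidiagonal] at h
    rw [if_neg, zero_smul]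
    rintro rfl
    simp at h; simp [h] at hne
  · simp

noncomputable instance twModule : Module (MvPolynomial τ B) (Tw j N) where
  one_smul u := by
    ext k
    simp only [tw_smul, DD_one, sum_anti_ite, one_smul]
  mul_smul p q u := by
    ext k
    simp only [tw_smul, DD_mul, Finset.sum_smul, Finset.smul_sum, Finset.sum_sigma']
    apply Finset.sum_nbij' (fun ⟨⟨_i, j⟩, ⟨k, l⟩⟩ ↦ ⟨(k, l + j), (l, j)⟩)
      (fun ⟨⟨i, _j⟩, ⟨k, l⟩⟩ ↦ ⟨(i + k, l), (i, k)⟩)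
    · rintro ⟨⟨a, b⟩, ⟨c, e⟩⟩ h; simp at h ⊢; omega
    · rintro ⟨⟨a, b⟩, ⟨c, e⟩⟩ h; simp at h ⊢; omega
    · rintro ⟨⟨a, b⟩, ⟨c, e⟩⟩ h; simp at h ⊢; omega
    · rintro ⟨⟨a, b⟩, ⟨c, e⟩⟩ h; simp at h ⊢; omega
    · rintro ⟨⟨a, b⟩, ⟨c, e⟩⟩ h; simp [mul_smul]
  smul_zero p := by
    ext k; simp [tw_smul, tw_zero]
  smul_add p u v := by
    ext k; simp only [tw_smul, tw_add, smul_add, Finset.sum_add_distrib]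
  add_smul p q u := by
    ext k; simp only [tw_smul, tw_add, map_add, add_smul, Finset.sum_add_distrib]
  zero_smul u := by
    ext k; simp [tw_smul, tw_zero]

lemma tw_C_smul (b : B) (u : Tw j N) (k : ℕ) : ((C b : MvPolynomial τ B) • u).co k =
    (C b : MvPolynomial τ B) • u.co k := by
  rw [tw_smul]; simp only [DD_C, sum_anti_ite]

lemma tw_smul_range (p : MvPolynomial τ B) (u : Tw j N) (k : ℕ) :
    (p • u).co k = p • u.co k + ∑ b ∈ Finset.range k, DD j (k - b) p • u.co b := by
  rw [tw_smul, ← Finset.Nat.sum_antidiagonal_swap]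
  simp only [Prod.fst_swap, Prod.snd_swap]
  rw [Finset.Nat.sum_antidiagonal_eq_sum_range_succ (fun a b => DD j b p • u.co a),
    Finset.sum_range_succ, Nat.sub_self, DD_zero', add_comm]

/-- recursive solution -/
noncomputable def solve (g : N → N) (c : ℕ → MvPolynomial τ B) (v : ℕ → N) : ℕ → N
  | k => g (v k - ∑ x : Fin k, c (k - x) • solve g c v x)
termination_by k => k
decreasing_by exact x.2

lemma tw_bij (f : MvPolynomial τ B) (hf : Function.Bijective (fun n : N => f • n)) :
    Function.Bijective (fun u : Tw j N => f • u) := by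
  constructor
  · intro u v h
    have h' : ∀ k, u.co k = v.co k := by
      intro k
      induction k using Nat.strong_induction_on with
      | _ k ih =>
        have := congrFun (congrArg Tw.co h) k
        dsimp only at this
        rw [tw_smul_range, tw_smul_range] at this
        rw [Finset.sum_congr rfl (fun b hb => by rw [ih b (Finset.mem_range.1 hb)])] at this
        exact hf.1 (add_right_cancel this)
    exact Tw.ext (funext h')
  · intro v
    choose g hg using hf.2
    refine ⟨⟨solve g (fun a => DD j a f) v.co⟩, Tw.ext (funext fun k => ?_)⟩
    dsimp only
    rw [tw_smul_range]
    dsimp only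
    have e : solve g (fun a => DD j a f) v.co k = g (v.co k - ∑ x : Fin k, DD j (k - x) f •
      solve g (fun a => DD j a f) v.co x) := by rw [solve]
    rw [e]
    have := hg (v.co k - ∑ x : Fin k, DD j (k - x) f • solve g (fun a => DD j a f) v.co x)
    dsimp only at this
    rw [this, Finset.sum_range (fun b => DD j (k - b) f • solve g (fun a => DD j a f) v.co b),
      sub_add_cancel]

end tw

section leib
variable {N : Type u} [AddCommGroup N] [Module B N] [Module (MvPolynomial τ B) N]
  [IsScalarTower B (MvPolynomial τ B) N]
variable {J : Finset τ} {d : τ → ℕ → N →ₗ[B] N}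

/-- the Taylor map -/
noncomputable def twMap (h : DOps J d) {j : τ} (hj : j ∈ J) : N →ₗ[MvPolynomial τ B] Tw j N where
  toFun n := ⟨fun k => d j k n⟩
  map_add' m n := by ext k; exact map_add _ _ _
  map_smul' p n := by
    dsimp only [RingHom.id_apply]
    induction p using MvPolynomial.induction_on generalizing n with
    | C b =>
      ext k
      rw [tw_C_smul, ← algebraMap_eq, algebraMap_smul, algebraMap_smul]
      exact map_smul _ _ _
    | add p q hp hq =>
      ext k
      have h1 := congrFun (congrArg Tw.co (hp n)) k
      have h2 := congrFun (congrArg Tw.co (hq n)) k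
      dsimp only at h1 h2
      dsimp only
      rw [add_smul, map_add, h1, h2, add_smul, tw_add]
    | mul_X p l hp =>
      rw [mul_smul, hp, mul_smul]
      congr 1
      ext k
      rw [tw_smul]
      dsimp only
      by_cases hl : l = j
      · subst hl
        cases k with
        | zero => simp [h.zero l hj, DD_zero']
        | succ k =>
          rw [h.leib l hj, Finset.sum_eq_add (0, k+1) (1, k)]
          · simp [DD_apply, tay_X_self, Polynomial.coeff_X, Polynomial.coeff_C]
          · simp
          · rintro ⟨a, b⟩ hab ⟨h1, h2⟩
            have : DD l a (X l : MvPolynomial τ B) = 0 := by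
              rw [Finset.HasAntidiagonal.mem_antidiagonal] at hab
              have h0 : a ≠ 0 := by rintro rfl; simp at hab; simp [hab] at h1
              have h3 : a ≠ 1 := by rintro rfl; simp at hab; apply h2; ext <;> simp; omega
              simp [DD_apply, tay_X_self, Polynomial.coeff_X, Polynomial.coeff_C, h0, Ne.symm h3]
            rw [this, zero_smul]
          · intro h; simp at h
          · intro h; simp [add_comm] at h
      · rw [h.comm j hj l hl]
        simp only [DD_apply, tay_X_ne hl, Polynomial.coeff_C]
        exact (sum_anti_ite k (fun b => d j b n) _).symm


lemma DOps.leibniz (h : DOps J d) {j : τ} (hj : j ∈ J) (k : ℕ) (p : MvPolynomial τ B) (n : N) :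
    d j k (p • n) = p • d j k n + ∑ b ∈ Finset.range k, DD j (k - b) p • d j b n := by
  have := congrFun (congrArg Tw.co ((twMap h hj).map_smul p n)) k
  rw [tw_smul_range] at this
  exact this

variable {N' : Type u} [AddCommGroup N'] [Module B N'] [Module (MvPolynomial τ B) N']
  [IsScalarTower B (MvPolynomial τ B) N']

/-- functoriality of `Tw` -/
noncomputable def twFun (j : τ) (φ : N →ₗ[MvPolynomial τ B] N') :
    Tw j N →ₗ[MvPolynomial τ B] Tw j N' where
  toFun u := ⟨fun k => φ (u.co k)⟩
  map_add' u v := by ext k; exact map_add _ _ _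
  map_smul' p u := by
    ext k
    simp only [tw_smul, map_sum, map_smul, RingHom.id_apply]

lemma loc_unit (f : MvPolynomial τ B) (φ : N →ₗ[MvPolynomial τ B] N')
    [IsLocalizedModule (Submonoid.powers f) φ] : Function.Bijective (fun n : N' => f • n) := by
  have := IsLocalizedModule.map_units φ (⟨f, 1, pow_one f⟩ : Submonoid.powers f)
  rw [Module.End.isUnit_iff] at this
  exact this

lemma exists_loc_ops (h : DOps J d) (f : MvPolynomial τ B) (φ : N →ₗ[MvPolynomial τ B] N')
    [IsLocalizedModule (Submonoid.powers f) φ] :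
    ∃ d' : τ → ℕ → N' →ₗ[B] N', DOps J d' ∧ ∀ j ∈ J, ∀ k n, d' j k (φ n) = φ (d j k n) := by
  have hu : ∀ (j : τ) (x : Submonoid.powers f),
      IsUnit (algebraMap (MvPolynomial τ B) (Module.End (MvPolynomial τ B) (Tw j N')) x) := by
    rintro j ⟨x, m, rfl⟩
    have : IsUnit (algebraMap (MvPolynomial τ B) (Module.End (MvPolynomial τ B) (Tw j N')) f) := by
      rw [Module.End.isUnit_iff]
      exact tw_bij j f (loc_unit f φ)
    simpa using this.pow m
  have key : ∀ j : τ, ∃ t : N' →ₗ[MvPolynomial τ B] Tw j N', ∀ hj : j ∈ J, ∀ n k,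
      (t (φ n)).co k = φ (d j k n) := by
    intro j
    by_cases hj : j ∈ J
    · refine ⟨IsLocalizedModule.lift (Submonoid.powers f) φ (twFun j φ ∘ₗ twMap h hj) (hu j),
        fun _ n k => ?_⟩
      rw [IsLocalizedModule.lift_apply]
      rfl
    · exact ⟨0, fun h => absurd h hj⟩
  choose t ht using key
  have hC : ∀ j k (b : B) n, (t j (b • n)).co k = b • (t j n).co k := by
    intro j k b n
    rw [← algebraMap_smul (MvPolynomial τ B) b n, map_smul, algebraMap_eq, tw_C_smul,
      ← algebraMap_eq, algebraMap_smul]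
  refine ⟨fun j k => ⟨⟨fun n => (t j n).co k, fun m n => by rw [map_add, tw_add]⟩, hC j k⟩,
    ⟨?_, ?_, ?_⟩, fun j hj k n => ht j hj n k⟩
  · intro j hj n
    let e : N' →ₗ[MvPolynomial τ B] N' := ⟨⟨fun n => (t j n).co 0, fun m n => by
      rw [map_add, tw_add]⟩, fun p n => by
        dsimp only
        rw [map_smul, tw_smul_range]; simp⟩
    have : e = LinearMap.id := by
      apply IsLocalizedModule.linearMap_ext (Submonoid.powers f) φ φ
      ext n
      exact (ht j hj n 0).trans (by rw [h.zero j hj]; rfl)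
    exact congrArg (fun e => e n) this
  · intro j hj k n
    change (t j (_ • n)).co (k+1) = (X j : MvPolynomial τ B) • (t j n).co (k+1) + (t j n).co k
    rw [map_smul, tw_smul_range, Finset.sum_eq_single k]
    · simp [DD_apply, tay_X_self, Polynomial.coeff_X, Polynomial.coeff_C]
    · intro b hb hbk
      rw [Finset.mem_range] at hb
      have h0 : k + 1 - b ≠ 0 := by omega
      have h1 : 1 ≠ k + 1 - b := by omega
      simp [DD_apply, tay_X_self, Polynomial.coeff_X, Polynomial.coeff_C, h0, h1]
    · simp
  · intro j hj l hl k n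
    change (t j (_ • n)).co k = (X l : MvPolynomial τ B) • (t j n).co k
    rw [map_smul, tw_smul_range, Finset.sum_eq_zero, add_zero]
    intro b hb
    rw [Finset.mem_range] at hb
    have h0 : k - b ≠ 0 := by omega
    simp [DD_apply, tay_X_ne hl, Polynomial.coeff_C, h0]

end leib
end S8
end BassLC

namespace BassLC

section S9
open MvPolynomial
variable {τ : Type} {B : Type u} [CommRing B] [DecidableEq τ]
variable {N : Type u} [AddCommGroup N] [Module B N] [Module (MvPolynomial τ B) N]
  [IsScalarTower B (MvPolynomial τ B) N]
variable {J : Finset τ} {d : τ → ℕ → N →ₗ[B] N}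
variable {N' : Type u} [AddCommGroup N'] [Module B N'] [Module (MvPolynomial τ B) N']
  [IsScalarTower B (MvPolynomial τ B) N']

theorem Good.loc (h : Good J d) (f : MvPolynomial τ B) (φ : N →ₗ[MvPolynomial τ B] N')
    [IsLocalizedModule (Submonoid.powers f) φ] :
    ∃ d' : τ → ℕ → N' →ₗ[B] N', Good J d' ∧ ∀ j ∈ J, ∀ k n, d' j k (φ n) = φ (d j k n) := by
  obtain ⟨d', hd', hc⟩ := exists_loc_ops h.ops f φ
  refine ⟨d', ⟨hd', ?_⟩, hc⟩
  obtain ⟨F, c, hF⟩ := h.fil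
  obtain ⟨δ, hδ⟩ := MM_exh f
  let G : ℕ → Submodule B N' := fun q => (F q).map (φ.restrictScalars B)
  have Gmono : Monotone G := fun a b hab => Submodule.map_mono (hF.mono hab)
  have Gsmul : ∀ p ∈ (MM τ B) ^ δ, ∀ q x, x ∈ G q → p • x ∈ G (q + δ) := by
    rintro p hp q x ⟨n, hn, rfl⟩
    exact ⟨p • n, MM_pow_smul hF δ p hp q n hn, map_smul φ p n⟩
  have Gpow : ∀ a q x, x ∈ G q → f ^ a • x ∈ G (q + δ * a) := by
    intro a
    induction a with
    | zero => intro q x hx; simpa using hx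
    | succ a ih =>
      intro q x hx
      rw [pow_succ', mul_smul]
      have := Gsmul f hδ _ _ (ih q x hx)
      rwa [add_assoc, ← Nat.mul_succ] at this
  have claim : ∀ j ∈ J, ∀ s n' q, f ^ s • n' ∈ G q → ∀ k,
      f ^ (s + k) • d' j k n' ∈ G (q + (δ + 1) * k) := by
    intro j hj s
    induction s with
    | zero =>
      rintro n' q hn k
      rw [pow_zero, one_smul] at hn
      obtain ⟨n, hn, rfl⟩ := hn
      have h1 : d' j k (φ n) ∈ G (q + k) := by
        rw [hc j hj]
        exact ⟨_, hF.d_mem j hj k q n hn, rfl⟩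
      rw [Nat.zero_add]
      refine Gmono (le_of_eq ?_) (Gpow k _ _ h1)
      ring
    | succ s ih =>
      intro n' q hn k
      induction k using Nat.strong_induction_on with
      | _ k ihk =>
        have h1 := ih (f • n') q (by rwa [← mul_smul, ← pow_succ]) k
        rw [hd'.leibniz hj] at h1
        have e : f ^ (s + 1 + k) • d' j k n' =
            f ^ (s + k) • (f • d' j k n' + ∑ b ∈ Finset.range k, DD j (k - b) f • d' j b n') -
            ∑ b ∈ Finset.range k, f ^ (k - b - 1) • (DD j (k - b) f • 
              (f ^ (s + 1 + b) • d' j b n')) := by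
          rw [smul_add, ← mul_smul, ← pow_succ, Finset.smul_sum,
            show s + k + 1 = s + 1 + k by ring]
          rw [eq_sub_iff_add_eq]
          congr 1
          refine Finset.sum_congr rfl fun b hb => ?_
          rw [Finset.mem_range] at hb
          rw [← mul_smul, ← mul_smul, ← mul_smul]
          congr 1
          have : s + k = (k - b - 1) + (s + 1 + b) := by omega
          rw [this, pow_add]; ring
        rw [e]
        refine Submodule.sub_mem _ h1 (Submodule.sum_mem _ fun b hb => ?_)
        rw [Finset.mem_range] at hb
        refine Gmono ?_ (Gpow (k - b - 1) _ _ (Gsmul _ (DD_mem j δ (k-b) f hδ) _ _ (ihk b hb)))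
        obtain ⟨a, rfl⟩ : ∃ a, k = b + 1 + a := ⟨k - (b + 1), by omega⟩
        rw [show b + 1 + a - b - 1 = a by omega]
        nlinarith
  let fs : ℕ → N' →ₗ[B] N' := fun s =>
    (LinearMap.lsmul (MvPolynomial τ B) N' (f ^ s)).restrictScalars B
  have fs_app : ∀ s n, fs s n = f ^ s • n := fun s n => rfl
  refine ⟨fun s => (G ((δ + 1) * s)).comap (fs s), c * (δ + 1) ^ J.card, ?_, ?_, ?_, ?_, ?_⟩
  · intro s t hst n hn
    change f ^ t • n ∈ G _
    change f ^ s • n ∈ G _ at hn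
    obtain ⟨a, rfl⟩ := Nat.exists_eq_add_of_le hst
    rw [add_comm s a, pow_add, mul_smul]
    refine Gmono ?_ (Gpow a _ _ hn)
    nlinarith
  · intro n'
    obtain ⟨⟨n, ⟨x, t, rfl⟩⟩, hx⟩ := IsLocalizedModule.surj (Submonoid.powers f) φ n'
    obtain ⟨q, hq⟩ := hF.exh n
    have hx' : f ^ t • n' = φ n := hx
    refine ⟨q + t, ?_⟩
    change f ^ (q + t) • n' ∈ G _
    rw [pow_add, mul_smul, hx']
    refine Gmono ?_ (Gpow q q _ ⟨n, hq, rfl⟩)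
    nlinarith
  · intro l s n hn
    obtain ⟨m, hm, hmn⟩ := (show f ^ s • n ∈ G _ from hn)
    change f ^ (s+1) • (X l : MvPolynomial τ B) • n ∈ G _
    have h1 : (X l : MvPolynomial τ B) • (f ^ s • n) ∈ G ((δ + 1) * s + 1) := by
      rw [← hmn]
      exact ⟨_, hF.X_mem l _ _ hm, map_smul φ _ _⟩
    have h2 := Gpow 1 _ _ h1
    rw [pow_one] at h2
    rw [← mul_smul]
    have : f ^ (s+1) * X l = f * (X l * f ^ s) := by ring
    rw [this, mul_smul, mul_smul]
    refine Gmono (le_of_eq ?_) h2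
    ring
  · intro j hj k s n hn
    have := claim j hj s n _ hn k
    change f ^ (s + k) • _ ∈ G _
    rwa [Nat.mul_add]
  · intro s
    have h1 : Module.length B ((G ((δ + 1) * s)).comap (fs s)) ≤
        Module.length B (G ((δ + 1) * s)) := by
      refine Module.length_le_of_injective ((fs s).restrict (q := G ((δ + 1) * s)) fun x hx => hx) ?_
      rintro ⟨x, hx⟩ ⟨y, hy⟩ hxy
      have hxy' : f ^ s • x = f ^ s • y := congrArg Subtype.val hxy
      apply Subtype.ext
      have hb : Function.Injective (fun n : N' => f ^ s • n) := by
        have := (loc_unit f φ).1.iterate s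
        rwa [show (fun n : N' => f • n)^[s] = fun n => f ^ s • n from smul_iterate f s] at this
      exact hb hxy'
    have h2 : Module.length B (G ((δ + 1) * s)) ≤ Module.length B (F ((δ + 1) * s)) := by
      refine Module.length_le_of_surjective ((φ.restrictScalars B).submoduleMap _) ?_
      exact LinearMap.submoduleMap_surjective _ _
    refine h1.trans (h2.trans ((hF.len _).trans ?_))
    norm_cast
    rw [mul_assoc, ← mul_pow]
    refine Nat.mul_le_mul_left _ (Nat.pow_le_pow_left ?_ _)
    nlinarith
end S9
end BassLC

namespace BassLC

section S10
open MvPolynomial TensorProduct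
variable {τ : Type} {B : Type u} [CommRing B]

/-- `N` carries a good structure -/
def GG (J : Finset τ) (N : Type u) [AddCommGroup N] [Module (MvPolynomial τ B) N] : Prop :=
  ∃ (_ : Module B N) (_ : IsScalarTower B (MvPolynomial τ B) N) (d : τ → ℕ → N →ₗ[B] N), Good J d

section basic
variable {J : Finset τ} {N : Type u} [AddCommGroup N] [Module (MvPolynomial τ B) N]
  {N' : Type u} [AddCommGroup N'] [Module (MvPolynomial τ B) N']

variable (τ B N) in
/-- module by restriction -/
noncomputable abbrev bMod : Module B N := Module.compHom N (C : B →+* MvPolynomial τ B)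

variable (τ B N) in
lemma bTower : letI := bMod τ B N; IsScalarTower B (MvPolynomial τ B) N := by
  letI := bMod τ B N
  refine ⟨fun b s x => ?_⟩
  rw [MvPolynomial.smul_eq_C_mul, mul_smul]; rfl

lemma GG.ker [DecidableEq τ] (h : GG (B := B) J N) {j : τ} (hj : j ∈ J) (a : B) :
    GG (B := B) (J.erase j) (LinearMap.ker (yy N j a)) := by
  obtain ⟨i1, i2, d, hd⟩ := h
  obtain ⟨d', hd'⟩ := hd.ker hj a
  exact ⟨_, inferInstance, d', hd'⟩

lemma GG.coker [DecidableEq τ] (h : GG (B := B) J N) {j : τ} (hj : j ∈ J) (a : B) :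
    GG (B := B) (J.erase j) (N ⧸ LinearMap.range (yy N j a)) := by
  obtain ⟨i1, i2, d, hd⟩ := h
  obtain ⟨d', hd'⟩ := hd.coker hj a
  exact ⟨_, inferInstance, d', hd'⟩

lemma GG.equiv (h : GG (B := B) J N) (e : N ≃ₗ[MvPolynomial τ B] N') : GG (B := B) J N' := by
  obtain ⟨i1, i2, d, hd⟩ := h
  letI := bMod τ B N'
  have := bTower τ B N'
  let e' : N ≃ₗ[B] N' := e.restrictScalars B
  refine ⟨_, this, fun j k => e'.toLinearMap ∘ₗ d j k ∘ₗ e'.symm.toLinearMap, 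
    hd.of_surjective e.toLinearMap e.surjective ?_⟩
  intro j hj k n
  change e (d j k (e.symm (e n))) = e (d j k n)
  rw [e.symm_apply_apply]

end basic

variable {R : Type u} [CommRing R] [Algebra R (MvPolynomial τ B)] {m : ℕ} (f : Fin m → R)
  (N : Type u) [AddCommGroup N] [Module R N] [Module (MvPolynomial τ B) N]
  [IsScalarTower R (MvPolynomial τ B) N]

variable (τ B) in
/-- `mL` as a linear map over the big ring -/
noncomputable def mLS : N →ₗ[MvPolynomial τ B] N ⊗[R] LL f where
  toFun n := n ⊗ₜ 1
  map_add' a b := TensorProduct.add_tmul _ _ _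
  map_smul' p n := rfl

variable (τ B) in
/-- `mK` as a linear map over the big ring -/
noncomputable def mKS : N ⊗[R] LL f →ₗ[MvPolynomial τ B] N ⊗[R] KK f :=
  TensorProduct.AlgebraTensorModule.lTensor (MvPolynomial τ B) N (Submodule.mkQ _)

variable (τ B) in
/-- map to one localization -/
noncomputable def mG (g : R) : N →ₗ[MvPolynomial τ B] N ⊗[R] Localization.Away g where
  toFun n := n ⊗ₜ 1
  map_add' a b := TensorProduct.add_tmul _ _ _
  map_smul' p n := rfl

instance mG_loc (g : R) : IsLocalizedModule (Submonoid.powers (algebraMap R (MvPolynomial τ B) g))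
    (mG τ B N g) := by
  rw [← Algebra.algebraMapSubmonoid_powers]
  have : IsLocalizedModule (Submonoid.powers g) ((mG τ B N g).restrictScalars R) :=
    loc_right N g
  exact IsLocalizedModule.of_restrictScalars _ _

theorem GG.tensor_aux [DecidableEq τ] {J : Finset τ} [Module B N]
    [IsScalarTower B (MvPolynomial τ B) N] [Module B (N ⊗[R] LL f)]
    [IsScalarTower B (MvPolynomial τ B) (N ⊗[R] LL f)]
    {d : τ → ℕ → N →ₗ[B] N} (h : Good J d) :
    ∃ d' : τ → ℕ → (N ⊗[R] LL f) →ₗ[B] (N ⊗[R] LL f), Good J d' ∧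
      ∀ j ∈ J, ∀ k n, d' j k (mLS τ B f N n) = mLS τ B f N (d j k n) := by
  letI (i : Fin m) := bMod τ B (N ⊗[R] Localization.Away (f i))
  have := fun i => bTower τ B (N ⊗[R] Localization.Away (f i))
  have H := fun i => h.loc (algebraMap R (MvPolynomial τ B) (f i)) (mG τ B N (f i))
  choose d' hd' hc using H
  have hp := Good.pi hd'
  let e : (N ⊗[R] LL f) ≃ₗ[MvPolynomial τ B] ∀ i, N ⊗[R] Localization.Away (f i) :=
    TensorProduct.piRight R (MvPolynomial τ B) N (fun i => Localization.Away (f i))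
  have he : ∀ n, e (mLS τ B f N n) = fun i => mG τ B N (f i) n := by
    intro n
    change e (n ⊗ₜ 1) = fun i => n ⊗ₜ 1
    ext i
    simp [e]
  let e' : (N ⊗[R] LL f) ≃ₗ[B] ∀ i, N ⊗[R] Localization.Away (f i) := e.restrictScalars B
  refine ⟨fun j k => e'.symm.toLinearMap ∘ₗ piOps d' j k ∘ₗ e'.toLinearMap,
    hp.of_injective e.toLinearMap e.injective ?_, ?_⟩
  · intro j hj k n
    exact e.apply_symm_apply _
  · intro j hj k n
    apply e.injective
    refine (e.apply_symm_apply (piOps d' j k (e (mLS τ B f N n)))).trans ?_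
    rw [he, he]
    ext i
    exact hc i j hj k n

variable {N} in
theorem GG.tensor [DecidableEq τ] {J : Finset τ} (h : GG (B := B) J N) :
    GG (B := B) J (N ⊗[R] KK f) ∧ GG (B := B) J (LinearMap.ker (mLS τ B f N)) := by
  obtain ⟨i1, i2, d, hd⟩ := h
  letI := bMod τ B (N ⊗[R] LL f)
  have := bTower τ B (N ⊗[R] LL f)
  letI := bMod τ B (N ⊗[R] KK f)
  have := bTower τ B (N ⊗[R] KK f)
  obtain ⟨d', hd', hc⟩ := GG.tensor_aux f N hd
  have hs : Function.Surjective (mKS τ B f N) := mK_surj f N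
  have hex : Function.Exact (mLS τ B f N) (mKS τ B f N) := mLK_exact f N
  constructor
  · obtain ⟨d2, hd2⟩ := exists_quot_ops (d := d') ((mKS τ B f N).restrictScalars B) hs J (by
      intro j hj k n hn
      obtain ⟨n0, rfl⟩ := (hex n).1 hn
      refine (congrArg (mKS τ B f N) (hc j hj k n0)).trans ?_
      exact (hex _).2 ⟨_, rfl⟩)
    exact ⟨_, inferInstance, d2, hd'.of_surjective (mKS τ B f N) hs hd2⟩
  · obtain ⟨d2, hd2⟩ := exists_sub_ops (d := d)
      ((LinearMap.ker (mLS τ B f N)).subtype.restrictScalars B) (Submodule.injective_subtype _) J (by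
      rintro j hj k ⟨n, hn⟩
      refine ⟨⟨d j k n, ?_⟩, rfl⟩
      rw [LinearMap.mem_ker] at hn ⊢
      rw [← hc j hj, hn, map_zero])
    exact ⟨_, inferInstance, d2, hd.of_injective (LinearMap.ker (mLS τ B f N)).subtype
      (Submodule.injective_subtype _) hd2⟩

theorem GG_Kc [DecidableEq τ] [Fintype τ] [IsArtinianRing B] (i : ℕ) :
    GG (B := B) (Finset.univ : Finset τ) (MvPolynomial τ B ⊗[R] Kc f i) := by
  induction i with
  | zero =>
    have h0 : GG (B := B) (Finset.univ : Finset τ) (MvPolynomial τ B) := ⟨_, inferInstance, _, Good.poly⟩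
    exact h0.equiv (TensorProduct.AlgebraTensorModule.rid R (MvPolynomial τ B) (MvPolynomial τ B)).symm
  | succ i ih =>
    have h1 := (GG.tensor f ih).1
    exact h1.equiv (TensorProduct.AlgebraTensorModule.assoc R R (MvPolynomial τ B)
      (MvPolynomial τ B) (Kc f i) (KK f))

end S10
end BassLC

namespace BassLC

section S11
open Abelian

section generic
variable {Q : Type u} [CommRing Q] (κ : Type u) [AddCommGroup κ] [Module Q κ]

/-- Ext of modules -/
abbrev EE (Q : Type u) [CommRing Q] (κ : Type u) [AddCommGroup κ] [Module Q κ]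
    (M : Type u) [AddCommGroup M] [Module Q M] (k : ℕ) :=
  Ext (ModuleCat.of Q κ) (ModuleCat.of Q M) k

variable {M M' M'' : Type u} [AddCommGroup M] [Module Q M] [AddCommGroup M'] [Module Q M']
  [AddCommGroup M''] [Module Q M'']

/-- functoriality -/
noncomputable def eM (φ : M →ₗ[Q] M') (k : ℕ) : EE Q κ M k →ₗ[Q] EE Q κ M' k where
  toFun x := x.comp (Ext.mk₀ (ModuleCat.ofHom φ)) (add_zero k)
  map_add' x y := Ext.add_comp _ _ _ _
  map_smul' r x := Ext.smul_comp _ _ _ _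

lemma eM_apply (φ : M →ₗ[Q] M') (k : ℕ) (x : EE Q κ M k) :
  eM κ φ k x = x.comp (Ext.mk₀ (ModuleCat.ofHom φ)) (add_zero k) := rfl

lemma eM_comp (φ : M →ₗ[Q] M') (ψ : M' →ₗ[Q] M'') (k : ℕ) (x : EE Q κ M k) :
    eM κ (ψ ∘ₗ φ) k x = eM κ ψ k (eM κ φ k x) := by
  rw [eM_apply, eM_apply, eM_apply, Ext.comp_assoc_of_third_deg_zero, Ext.mk₀_comp_mk₀]
  rfl

lemma eM_id (k : ℕ) (x : EE Q κ M k) : eM κ (LinearMap.id : M →ₗ[Q] M) k x = x := by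
  rw [eM_apply]
  exact Ext.comp_mk₀_id x

lemma eM_smul_id (r : Q) (k : ℕ) (x : EE Q κ M k) :
    eM κ (r • (LinearMap.id : M →ₗ[Q] M)) k x = r • x := by
  have : ModuleCat.ofHom (r • (LinearMap.id : M →ₗ[Q] M)) = r • 𝟙 (ModuleCat.of Q M) := rfl
  rw [eM_apply, this, Ext.mk₀_smul, Ext.comp_smul, Ext.comp_mk₀_id]

lemma ee_smul_zero (r : Q) (hr : ∀ x : κ, r • x = 0) (k : ℕ) (x : EE Q κ M k) : r • x = 0 := by
  have h0 : r • 𝟙 (ModuleCat.of Q κ) = 0 := by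
    ext x; exact hr x
  have h1 : r • x = (Ext.mk₀ (r • 𝟙 (ModuleCat.of Q κ))).comp x (zero_add k) := by
    rw [Ext.mk₀_smul, Ext.smul_comp, Ext.mk₀_id_comp]
  rw [h1, h0, Ext.mk₀_zero, Ext.zero_comp]

lemma fg_of_le [IsNoetherianRing Q] {E : Type*} [AddCommGroup E] [Module Q E] {s t : Submodule Q E}
    (h : s ≤ t) (ht : t.FG) : s.FG := by
  have : Module.Finite Q t := Module.Finite.iff_fg.2 ht
  have h2 : IsNoetherian Q t := inferInstance
  have := isNoetherian_of_le (s := s) (t := t) h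
  exact Module.Finite.iff_fg.1 inferInstance

lemma ker_comp_fg [IsNoetherianRing Q] {E₁ E₂ E₃ : Type*} [AddCommGroup E₁] [Module Q E₁]
    [AddCommGroup E₂] [Module Q E₂] [AddCommGroup E₃] [Module Q E₃] (π : E₁ →ₗ[Q] E₂)
    (ι : E₂ →ₗ[Q] E₃) (h1 : (LinearMap.ker π).FG) (h2 : (LinearMap.ker ι).FG) :
    (LinearMap.ker (ι ∘ₗ π)).FG := by
  apply Submodule.fg_of_fg_map_of_fg_inf_ker π
  · refine fg_of_le ?_ h2
    rintro _ ⟨x, hx, rfl⟩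
    exact hx
  · exact fg_of_le inf_le_right h1

lemma eM_ker_fg [IsNoetherianRing Q] {K C : Type u} [AddCommGroup K] [Module Q K]
    [AddCommGroup C] [Module Q C] (i : K →ₗ[Q] M) (φ : M →ₗ[Q] M) (p : M →ₗ[Q] C)
    (hi : Function.Injective i) (h1 : Function.Exact i φ) (h2 : Function.Exact φ p)
    (hp : Function.Surjective p) (hK : ∀ k, Module.Finite Q (EE Q κ K k))
    (hC : ∀ k, Module.Finite Q (EE Q κ C k)) (k : ℕ) : (LinearMap.ker (eM κ φ k)).FG := by
  have S1 := mkSES i φ.rangeRestrict hi φ.surjective_rangeRestrict (by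
    intro x; rw [← h1 x]; simp [Subtype.ext_iff])
  have S2 := mkSES (LinearMap.range φ).subtype p (Submodule.injective_subtype _) hp (by
    intro x; rw [h2 x]; simp)
  have e : eM κ φ k = eM κ (LinearMap.range φ).subtype k ∘ₗ eM κ φ.rangeRestrict k := by
    ext x
    rw [LinearMap.comp_apply, ← eM_comp]; rfl
  rw [e]
  apply ker_comp_fg
  · have : LinearMap.ker (eM κ φ.rangeRestrict k) ≤ LinearMap.range (eM κ i k) := by
      intro x hx
      obtain ⟨y, hy⟩ := Ext.covariant_sequence_exact₂ _ S1 x hx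
      exact ⟨y, hy⟩
    refine fg_of_le this ?_
    rw [LinearMap.range_eq_map]
    have := hK k
    exact Submodule.FG.map _ Module.Finite.fg_top
  · cases k with
    | zero =>
      have : LinearMap.ker (eM κ (LinearMap.range φ).subtype 0) = ⊥ := by
        rw [LinearMap.ker_eq_bot']
        intro x hx
        have : Mono (ModuleCat.ofHom (LinearMap.range φ).subtype) := S2.mono_f
        exact Ext.postcomp_mk₀_injective_of_mono (ModuleCat.of Q κ)
          (ModuleCat.ofHom (LinearMap.range φ).subtype) (by
            rw [map_zero]; exact hx)
      rw [this]; exact Submodule.fg_bot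
    | succ k =>
      let δ : EE Q κ C k →ₗ[Q] EE Q κ (LinearMap.range φ) (k+1) :=
        { toFun := fun x => x.comp S2.extClass rfl
          map_add' := fun x y => Ext.add_comp _ _ _ _
          map_smul' := fun r x => Ext.smul_comp _ _ _ _ }
      have : LinearMap.ker (eM κ (LinearMap.range φ).subtype (k+1)) ≤ LinearMap.range δ := by
        intro x hx
        obtain ⟨y, hy⟩ := Ext.covariant_sequence_exact₁ _ S2 x hx rfl
        exact ⟨y, hy⟩
      refine fg_of_le this ?_
      rw [LinearMap.range_eq_map δ]
      have := hC k
      exact Submodule.FG.map _ Module.Finite.fg_top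

end generic

section dev
open MvPolynomial
variable {τ : Type} {B : Type u} [CommRing B] [DecidableEq τ]
variable {R : Type u} [CommRing R] [Algebra R (MvPolynomial τ B)] (P : Ideal R) [P.IsPrime]

section
variable (N : Type u) [AddCommGroup N] [Module R N] [Module (MvPolynomial τ B) N]
  [IsScalarTower R (MvPolynomial τ B) N]

/-- multiplication on the localization -/
noncomputable def mu (p : MvPolynomial τ B) : LocalizedModule P.primeCompl N →ₗ[Localization.AtPrime P]
    LocalizedModule P.primeCompl N :=
  LocalizedModule.map P.primeCompl ((LinearMap.lsmul (MvPolynomial τ B) N p).restrictScalars R)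

lemma mu_mk (p : MvPolynomial τ B) (x : N) (s : P.primeCompl) :
    mu P N p (LocalizedModule.mk x s) = LocalizedModule.mk (p • x) s := by
  simp [mu, LocalizedModule.map_mk]

lemma mu_mul (p q : MvPolynomial τ B) : mu P N (p * q) = mu P N p ∘ₗ mu P N q := by
  ext x
  induction x using LocalizedModule.induction_on with
  | h x s => rw [LinearMap.comp_apply, mu_mk, mu_mk, mu_mk, mul_smul]

lemma mu_one : mu P N (1 : MvPolynomial τ B) = LinearMap.id := by
  ext x
  induction x using LocalizedModule.induction_on with
  | h x s => rw [mu_mk, one_smul]; rfl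

lemma mu_alg (r : R) : mu P N (algebraMap R (MvPolynomial τ B) r) =
    (algebraMap R (Localization.AtPrime P) r) • LinearMap.id := by
  ext x
  induction x using LocalizedModule.induction_on with
  | h x s =>
    rw [mu_mk, algebraMap_smul, LinearMap.smul_apply, LinearMap.id_apply, algebraMap_smul,
      LocalizedModule.smul'_mk]
end

set_option maxHeartbeats 2000000 in
lemma hone_aux [IsNoetherianRing (Localization.AtPrime P)] 
    (κ : Type u) [AddCommGroup κ] [Module (Localization.AtPrime P) κ]
    (N : Type u) [AddCommGroup N] [Module R N] [Module (MvPolynomial τ B) N]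
    [IsScalarTower R (MvPolynomial τ B) N] (j : τ) (a : B)
    (f1 : ∀ k, Module.Finite (Localization.AtPrime P) (EE (Localization.AtPrime P) κ
      (LocalizedModule P.primeCompl (LinearMap.ker (yy N j a))) k))
    (f2 : ∀ k, Module.Finite (Localization.AtPrime P) (EE (Localization.AtPrime P) κ
      (LocalizedModule P.primeCompl (N ⧸ LinearMap.range (yy N j a))) k)) (k : ℕ) :
    (LinearMap.ker (eM κ (mu P N (X j - C a : MvPolynomial τ B)) k)).FG := by
  have e1 : Function.Exact ((LinearMap.ker (yy N j a)).subtype.restrictScalars R)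
      ((LinearMap.lsmul (MvPolynomial τ B) N (X j - C a)).restrictScalars R) :=
    LinearMap.exact_subtype_ker_map (yy N j a)
  have e2 : Function.Exact 
      ((LinearMap.lsmul (MvPolynomial τ B) N (X j - C a)).restrictScalars R)
      ((LinearMap.range (yy N j a)).mkQ.restrictScalars R) :=
    LinearMap.exact_map_mkQ_range (yy N j a)
  have e3 := LocalizedModule.map_exact P.primeCompl _ _ e1
  have e4 := LocalizedModule.map_exact P.primeCompl _ _ e2
  have e5 := LocalizedModule.map_injective P.primeCompl
    ((LinearMap.ker (yy N j a)).subtype.restrictScalars R) (Submodule.injective_subtype _)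
  have e6 := LocalizedModule.map_surjective P.primeCompl
    ((LinearMap.range (yy N j a)).mkQ.restrictScalars R) (Submodule.mkQ_surjective _)
  exact eM_ker_fg κ
        (LocalizedModule.map P.primeCompl ((LinearMap.ker (yy N j a)).subtype.restrictScalars R)) 
        (mu P N (X j - C a : MvPolynomial τ B))
        (LocalizedModule.map P.primeCompl ((LinearMap.range (yy N j a)).mkQ.restrictScalars R))
        e5 e3 e4 e6 f1 f2 k

set_option maxHeartbeats 1000000 in
theorem devissage [IsNoetherianRing (Localization.AtPrime P)] 
    (κ : Type u) [AddCommGroup κ] [Module (Localization.AtPrime P) κ]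
    (hκ : ∀ r ∈ P, ∀ x : κ, (algebraMap R (Localization.AtPrime P) r) • x = 0)
    (hr : ∀ j : τ, ∃ (L : List B) (s r : R), s ∉ P ∧ r ∈ P ∧
      algebraMap R (MvPolynomial τ B) r = algebraMap R (MvPolynomial τ B) s *
        (L.map (fun a => (X j - C a : MvPolynomial τ B))).prod)
    (hbase : ∀ (N : Type u) [AddCommGroup N] [Module R N] [Module (MvPolynomial τ B) N]
      [IsScalarTower R (MvPolynomial τ B) N] [Module B N] [IsScalarTower B (MvPolynomial τ B) N],
      Module.Finite B N → Module.Finite (Localization.AtPrime P) (LocalizedModule P.primeCompl N))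
    (hκfin : Module.Finite (Localization.AtPrime P) κ)
    (J : Finset τ) : ∀ (N : Type u) [AddCommGroup N] [Module R N] [Module (MvPolynomial τ B) N]
      [IsScalarTower R (MvPolynomial τ B) N], GG (B := B) J N → ∀ k,
      Module.Finite (Localization.AtPrime P)
        (EE (Localization.AtPrime P) κ (LocalizedModule P.primeCompl N) k) := by
  induction J using Finset.induction_on with
  | empty =>
    rintro N _ _ _ _ ⟨_, _, d, hd⟩ k
    have h1 := hbase N hd.finite
    have : Module.Finite (Localization.AtPrime P) (ModuleCat.of (Localization.AtPrime P) κ) := hκfin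
    have : Module.Finite (Localization.AtPrime P) (ModuleCat.of (Localization.AtPrime P)
      (LocalizedModule P.primeCompl N)) := h1
    exact inferInstance
  | insert j J hj ih =>
    intro N _ _ _ _ hN k
    have hone : ∀ a : B, (LinearMap.ker (eM κ (mu P N (X j - C a : MvPolynomial τ B)) k)).FG := by
      intro a
      have g1 := hN.ker (Finset.mem_insert_self j J) a
      have g2 := hN.coker (Finset.mem_insert_self j J) a
      rw [Finset.erase_insert hj] at g1 g2
      have f1 := ih _ g1
      have f2 := ih _ g2
      exact hone_aux P κ N j a f1 f2 k
    have hlist : ∀ L : List B, (LinearMap.ker (eM κ (mu P N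
        (L.map (fun a => (X j - C a : MvPolynomial τ B))).prod) k)).FG := by
      intro L
      induction L with
      | nil =>
        have : LinearMap.ker (eM κ (mu P N (1 : MvPolynomial τ B)) k) = ⊥ := by
          rw [LinearMap.ker_eq_bot']
          intro x hx
          rwa [mu_one, eM_id] at hx
        rw [List.map_nil, List.prod_nil, this]
        exact Submodule.fg_bot
      | cons a L ihL =>
        rw [List.map_cons, List.prod_cons, mu_mul]
        have e : eM κ (mu P N (X j - C a : MvPolynomial τ B) ∘ₗ
            mu P N (L.map (fun a => (X j - C a : MvPolynomial τ B))).prod) k =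
            eM κ (mu P N (X j - C a : MvPolynomial τ B)) k ∘ₗ 
            eM κ (mu P N (L.map (fun a => (X j - C a : MvPolynomial τ B))).prod) k := by
          ext x
          rw [LinearMap.comp_apply, ← eM_comp]
        rw [e]
        exact ker_comp_fg _ _ ihL (hone a)
    obtain ⟨L, s, r, hs, hrP, hrs⟩ := hr j
    have htop : LinearMap.ker (eM κ (mu P N
        (L.map (fun a => (X j - C a : MvPolynomial τ B))).prod) k) = ⊤ := by
      rw [eq_top_iff]
      rintro x -
      rw [LinearMap.mem_ker]
      have h1 := ee_smul_zero κ (M := LocalizedModule P.primeCompl N) _ (hκ r hrP) k x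
      rw [← eM_smul_id, ← mu_alg (τ := τ) (B := B), hrs, mu_mul, eM_comp, mu_alg, eM_smul_id] at h1
      have hu : IsUnit (algebraMap R (Localization.AtPrime P) s) :=
        IsLocalization.map_units (Localization.AtPrime P) (⟨s, hs⟩ : P.primeCompl)
      exact (hu.smul_eq_zero).1 h1
    have := hlist L
    rw [htop] at this
    exact ⟨this⟩
end dev
end S11
end BassLC

namespace BassLC

section S12
open Abelian MvPolynomial TensorProduct

lemma fin_retract {Q : Type u} [CommRing Q] [IsNoetherianRing Q] (κ : Type u) [AddCommGroup κ]
    [Module Q κ] {M M' : Type u} [AddCommGroup M] [Module Q M] [AddCommGroup M'] [Module Q M']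
    (a : M →ₗ[Q] M') (b : M' →ₗ[Q] M) (h : b ∘ₗ a = LinearMap.id) (k : ℕ)
    (hf : Module.Finite Q (EE Q κ M' k)) : Module.Finite Q (EE Q κ M k) := by
  refine Module.Finite.of_injective (eM κ a k) (Function.LeftInverse.injective (g := eM κ b k) ?_)
  intro x
  rw [← eM_comp, h, eM_id]

lemma fin_equiv {R : Type u} [CommRing R] (P : Ideal R) [P.IsPrime]
    [IsNoetherianRing (Localization.AtPrime P)]
    (κ : Type u) [AddCommGroup κ] [Module (Localization.AtPrime P) κ]
    {N N' : Type u} [AddCommGroup N] [Module R N] [AddCommGroup N'] [Module R N']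
    (e : N ≃ₗ[R] N') (k : ℕ)
    (hf : Module.Finite (Localization.AtPrime P)
      (EE (Localization.AtPrime P) κ (LocalizedModule P.primeCompl N') k)) :
    Module.Finite (Localization.AtPrime P)
      (EE (Localization.AtPrime P) κ (LocalizedModule P.primeCompl N) k) := by
  refine fin_retract κ (LocalizedModule.map P.primeCompl e.toLinearMap)
    (LocalizedModule.map P.primeCompl e.symm.toLinearMap) ?_ k hf
  ext x
  induction x using LocalizedModule.induction_on with
  | h x s => simp [LocalizedModule.map_mk]

theorem finish {τ : Type} [DecidableEq τ] [Fintype τ] {B : Type u} [CommRing B] [IsArtinianRing B]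
    {R : Type u} [CommRing R] [IsNoetherianRing R] [Algebra R (MvPolynomial τ B)]
    (I P : Ideal R) [P.IsPrime]
    (ρ : MvPolynomial τ B →ₗ[R] Localization.AtPrime P) (hρ : ρ 1 = 1)
    (hr : ∀ j : τ, ∃ (L : List B) (s r : R), s ∉ P ∧ r ∈ P ∧
      algebraMap R (MvPolynomial τ B) r = algebraMap R (MvPolynomial τ B) s *
        (L.map (fun a => (X j - C a : MvPolynomial τ B))).prod)
    (hbase : ∀ (N : Type u) [AddCommGroup N] [Module R N] [Module (MvPolynomial τ B) N]
      [IsScalarTower R (MvPolynomial τ B) N] [Module B N] [IsScalarTower B (MvPolynomial τ B) N],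
      Module.Finite B N → Module.Finite (Localization.AtPrime P) (LocalizedModule P.primeCompl N))
    (i j : ℕ) :
    Module.Finite (Localization.AtPrime P)
      (bassExtModule R P j ((localCohomology I i).obj (ModuleCat.of R R))) := by
  have : IsNoetherianRing (Localization.AtPrime P) :=
    IsLocalization.isNoetherianRing P.primeCompl _ inferInstance
  obtain ⟨m, f, hI⟩ := Submodule.fg_iff_exists_fin_generating_family.1
    (IsNoetherian.noetherian I)
  have hI : Ideal.span (Set.range f) = I := hI
  let κ := IsLocalRing.ResidueField (Localization.AtPrime P)
  have hκfin : Module.Finite (Localization.AtPrime P) κ :=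
    Module.Finite.of_surjective (Algebra.linearMap (Localization.AtPrime P) κ)
      IsLocalRing.residue_surjective
  have hκ : ∀ r ∈ P, ∀ x : κ, (algebraMap R (Localization.AtPrime P) r) • x = 0 := by
    intro r hr x
    rw [Algebra.smul_def]
    have : algebraMap (Localization.AtPrime P) κ (algebraMap R (Localization.AtPrime P) r) = 0 := by
      change IsLocalRing.residue _ _ = 0
      rw [IsLocalRing.residue_eq_zero_iff]
      exact (IsLocalization.AtPrime.to_map_mem_maximal_iff (Localization.AtPrime P) P r).2 hr
    rw [this, zero_mul]
  have hG := (GG.tensor f (GG_Kc (τ := τ) (B := B) f i)).2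
  have h1 := devissage P κ hκ hr hbase hκfin Finset.univ _ hG j
  let N := MvPolynomial τ B ⊗[R] Kc f i
  have hk : ∀ x : N, x ∈ gam I N ↔ x ∈ LinearMap.ker (mLS τ B f N) := by
    intro x
    rw [gam_eq_ker f N I hI]; rfl
  let e : gam I N ≃ₗ[R] LinearMap.ker (mLS τ B f N) :=
    { toFun := fun x => ⟨x.1, (hk _).1 x.2⟩
      invFun := fun x => ⟨x.1, (hk _).2 x.2⟩
      map_add' := fun x y => rfl
      map_smul' := fun r x => rfl
      left_inv := fun x => rfl
      right_inv := fun x => rfl }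
  have h2 := fin_equiv (N := gam I N) (N' := LinearMap.ker (mLS τ B f N)) P κ e j h1
  obtain ⟨a, b, hab⟩ := retract_localized I P (Kc f i) (MvPolynomial τ B) ρ hρ
  have h3 := fin_retract κ a b hab j h2
  obtain ⟨e0⟩ := lc_gam f I hI i
  have h4 := fin_equiv (N' := gam I (Kc f i)) P κ e0 j h3
  exact Module.Finite.equiv (oldEquiv (projectiveResolution _) _ j).symm

end S12
end BassLC

namespace BassLC

section S13

lemma minimal_iff {D : Type*} [CommRing D] (p : Ideal D) :
    p ∈ minimalPrimes D ↔ p.IsPrime ∧ ∀ q : Ideal D, q.IsPrime → q ≤ p → p ≤ q := by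
  constructor
  · intro h
    exact ⟨h.1.1, fun q hq hle => h.2 ⟨hq, bot_le⟩ hle⟩
  · intro h
    exact ⟨⟨h.1, bot_le⟩, fun q hq hle => h.2 q hq.1 hle⟩

lemma minimal_comap_equiv {D E : Type*} [CommRing D] [CommRing E] (e : D ≃+* E) (q : Ideal E)
    (hq : q ∈ minimalPrimes E) : q.comap (e : D →+* E) ∈ minimalPrimes D := by
  rw [minimal_iff] at hq ⊢
  obtain ⟨h1, h2⟩ := hq
  refine ⟨Ideal.IsPrime.comap _, fun r hr hle => ?_⟩
  have h3 := h2 (r.comap (e.symm : E →+* D)) (Ideal.IsPrime.comap _) (by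
    intro x hx
    have h4 : e.symm x ∈ r := hx
    have h5 : e (e.symm x) ∈ q := hle h4
    rwa [e.apply_symm_apply] at h5)
  intro x hx
  have h4 : e.symm (e x) ∈ r := h3 hx
  rwa [e.symm_apply_apply] at h4

open Polynomial in
lemma exists_lc {D R : Type*} [CommRing D] [CommRing R] (f : D[X] →+* R) (P : Ideal R)
    [P.IsPrime] (p : Ideal D) (hpP : p = P.comap (f.comp C)) (hp : p ∈ minimalPrimes D)
    (hn : P.comap f ∉ minimalPrimes D[X]) : ∃ h : D[X], f h ∈ P ∧ h.leadingCoeff ∉ p := by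
  by_contra hcon
  push Not at hcon
  apply hn
  rw [minimal_iff] at hp ⊢
  refine ⟨Ideal.IsPrime.comap _, fun q hq hle => ?_⟩
  have h1 : p ≤ q.comap C := hp.2 _ (Ideal.IsPrime.comap _) (by
    rw [hpP, ← Ideal.comap_comap]; exact Ideal.comap_mono hle)
  have key : ∀ (k : ℕ) (h : D[X]), h.support.card ≤ k → f h ∈ P → h ∈ q := by
    intro k
    induction k with
    | zero =>
      intro h hk _
      have : h = 0 := by simpa using hk
      rw [this]; exact q.zero_mem
    | succ k ih =>
      intro h hk hP
      by_cases h0 : h = 0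
      · rw [h0]; exact q.zero_mem
      have hlc := hcon h hP
      have e1 := h.eraseLead_add_C_mul_X_pow
      have hm : (C h.leadingCoeff : D[X]) ∈ q := h1 hlc
      have hm2 : f (C h.leadingCoeff) ∈ P := by
        rw [hpP] at hlc; exact hlc
      have e2 : f h.eraseLead ∈ P := by
        have : h.eraseLead = h - C h.leadingCoeff * X ^ h.natDegree := eq_sub_of_add_eq e1
        rw [this, map_sub, map_mul]
        exact P.sub_mem hP (P.mul_mem_right _ hm2)
      rw [← e1]
      refine q.add_mem (ih _ ?_ e2) (q.mul_mem_right _ hm)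
      have := eraseLead_support_card_lt h0
      omega
  intro h hh
  exact key _ h le_rfl hh

lemma exists_T {A : Type u} [CommRing A] (hA : ringKrullDim A = 0) (n : ℕ)
    (P : Ideal (MvPolynomial (Fin n) A)) [P.IsPrime] :
    ∃ T : Finset (Fin n),
      P.comap (MvPolynomial.rename (R := A) (Subtype.val : {x // x ∈ T} → Fin n)).toRingHom ∈
        minimalPrimes (MvPolynomial {x // x ∈ T} A) ∧
      ∀ j, j ∉ T → ∃ h : Polynomial (MvPolynomial {x // x ∈ T} A),
        Polynomial.eval₂ (MvPolynomial.rename (R := A)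
          (Subtype.val : {x // x ∈ T} → Fin n)).toRingHom (MvPolynomial.X j) h ∈ P ∧
        h.leadingCoeff ∉ P.comap (MvPolynomial.rename (R := A)
          (Subtype.val : {x // x ∈ T} → Fin n)).toRingHom := by
  let S : Set (Finset (Fin n)) := {T |
      P.comap (MvPolynomial.rename (R := A) (Subtype.val : {x // x ∈ T} → Fin n)).toRingHom ∈
        minimalPrimes (MvPolynomial {x // x ∈ T} A)}
  have hne : S.Nonempty := by
    refine ⟨∅, ?_⟩
    have : Ring.KrullDimLE 0 (MvPolynomial {x // x ∈ (∅ : Finset (Fin n))} A) := by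
      rw [Ring.krullDimLE_iff,
        ringKrullDim_eq_of_ringEquiv (MvPolynomial.isEmptyAlgEquiv A _).toRingEquiv, hA]
      rfl
    exact Ideal.mem_minimalPrimes_of_krullDimLE_zero _
  obtain ⟨T, hT⟩ := (Set.toFinite S).exists_maximal hne
  refine ⟨T, hT.1, fun j hj => ?_⟩
  refine exists_lc (Polynomial.eval₂RingHom (MvPolynomial.rename (R := A)
          (Subtype.val : {x // x ∈ T} → Fin n)).toRingHom (MvPolynomial.X j)) P _ ?_ hT.1 ?_
  · congr 1
    ext <;> simp
  · intro hmin
    have h1 : insert j T ∈ S := by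
      let e := ((MvPolynomial.renameEquiv A (Finset.subtypeInsertEquivOption hj)).trans
        (MvPolynomial.optionEquivLeft A {x // x ∈ T})).toRingEquiv
      have h2 := minimal_comap_equiv e _ hmin
      change _ ∈ minimalPrimes _
      convert h2 using 1
      rw [Ideal.comap_comap]
      congr 1
      apply MvPolynomial.ringHom_ext
      · intro r
        simp [e]
      · rintro ⟨x, hx⟩
        by_cases hxj : x = j
        · subst hxj
          simp [e, Finset.subtypeInsertEquivOption]
        · simp [e, Finset.subtypeInsertEquivOption, hxj]
    have := hT.2 h1 (Finset.subset_insert j T) (Finset.mem_insert_self j T)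
    exact hj this

/-- retraction splitting -/
lemma exists_split {A : Type u} [CommRing A] [IsLocalRing A] (g : Polynomial A) (hg : g.Monic) :
    ∃ (B : Type u) (_ : CommRing B) (_ : Algebra A B) (_ : Module.Finite A B)
      (ρ : B →ₗ[A] A) (L : List B), ρ 1 = 1 ∧
      g.map (algebraMap A B) = (L.map (fun a => (Polynomial.X - Polynomial.C a))).prod := by
  obtain ⟨B, _, _, _, _, _, hS⟩ := hg.exists_splits_map
  obtain ⟨m, hm⟩ := Polynomial.splits_iff_exists_multiset.1 hS
  rw [(hg.map _).leadingCoeff, Polynomial.C_1, one_mul] at hm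
  let b := Module.Free.chooseBasis A B
  have hu : ∃ i, IsUnit (b.repr 1 i) := by
    by_contra hcon
    push Not at hcon
    have h1 : (1 : B) ∈ (IsLocalRing.maximalIdeal A) • (⊤ : Submodule A B) := by
      rw [← b.sum_repr 1]
      refine Submodule.sum_mem _ fun i _ => Submodule.smul_mem_smul ?_ trivial
      exact hcon i
    have h2 : (⊤ : Submodule A B) ≤ (IsLocalRing.maximalIdeal A) • (⊤ : Submodule A B) := by
      intro x _
      have : x = (LinearMap.mulLeft A x) 1 := by simp
      rw [this]
      have h3 := Submodule.mem_map_of_mem (f := LinearMap.mulLeft A x) h1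
      rw [Submodule.map_smul''] at h3
      exact Submodule.smul_mono le_rfl le_top h3
    have h3 := Submodule.eq_bot_of_le_smul_of_le_jacobson_bot _ (⊤ : Submodule A B)
      Module.Finite.fg_top h2 (IsLocalRing.maximalIdeal_le_jacobson _)
    have : (1 : B) ∈ (⊥ : Submodule A B) := h3 ▸ trivial
    exact one_ne_zero ((Submodule.mem_bot A).1 this)
  obtain ⟨i, u, hu⟩ := hu
  refine ⟨B, inferInstance, inferInstance, inferInstance, (↑u⁻¹ : A) • b.coord i, m.toList, ?_, ?_⟩
  · simp [← hu]
  · rw [hm, ← Multiset.prod_coe, ← Multiset.map_coe, Multiset.coe_toList]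
end S13
end BassLC

namespace BassLC

section S14
open MvPolynomial

noncomputable def rhoAdd {τ : Type} {B R Q : Type u} [CommRing B] [CommRing R] [CommRing Q]
    [Algebra R Q] (θ : B →+ Q) (x : τ → R) : MvPolynomial τ B →+ Q :=
  (Finsupp.liftAddHom (fun m : τ →₀ ℕ =>
    (AddMonoidHom.mulRight (algebraMap R Q (m.prod fun j k => x j ^ k))).comp θ)).comp
    (MvPolynomial.basisMonomials τ B).repr.toLinearMap.toAddMonoidHom

lemma rhoAdd_monomial {τ : Type} {B R Q : Type u} [CommRing B] [CommRing R] [CommRing Q]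
    [Algebra R Q] (θ : B →+ Q) (x : τ → R) (m : τ →₀ ℕ) (b : B) :
    rhoAdd θ x (monomial m b) = θ b * algebraMap R Q (m.prod fun j k => x j ^ k) := by
  have h : (MvPolynomial.basisMonomials τ B).repr (monomial m b) = Finsupp.single m b := by
    have h1 : (monomial m b : MvPolynomial τ B) = b • (MvPolynomial.basisMonomials τ B) m := by
      rw [coe_basisMonomials, smul_monomial, smul_eq_mul, mul_one]
    rw [h1, map_smul, Module.Basis.repr_self]
    simp
  change (Finsupp.liftAddHom _) ((MvPolynomial.basisMonomials τ B).repr (monomial m b)) = _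
  rw [h]
  simp

lemma rhoAdd_linear {τ : Type} {D B R Q : Type u} [CommRing D] [CommRing B] [CommRing R]
    [CommRing Q] [Algebra R Q] (θ : B →+ Q) (x : τ → R) (ι : D →+* R) (β : D →+* B)
    (Φ : R →+* MvPolynomial τ B) (hΦι : ∀ e, Φ (ι e) = C (β e)) (hΦx : ∀ j, Φ (x j) = X j)
    (hgen : ∀ S : Subring R, (∀ e, ι e ∈ S) → (∀ j, x j ∈ S) → ∀ r, r ∈ S)
    (hθ : ∀ e b, θ (β e * b) = algebraMap R Q (ι e) * θ b) (r : R) (s : MvPolynomial τ B) :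
    rhoAdd θ x (Φ r * s) = algebraMap R Q r * rhoAdd θ x s := by
  let S : Subring R :=
    { carrier := {r | ∀ s, rhoAdd θ x (Φ r * s) = algebraMap R Q r * rhoAdd θ x s}
      mul_mem' := by
        intro a b ha hb s
        rw [map_mul Φ, mul_assoc, ha, hb, map_mul (algebraMap R Q), mul_assoc]
      one_mem' := by
        intro s
        rw [map_one, map_one, one_mul, one_mul]
      add_mem' := by
        intro a b ha hb s
        rw [map_add, add_mul, map_add, ha, hb, map_add, add_mul]
      zero_mem' := by
        intro s
        rw [map_zero, map_zero, zero_mul, zero_mul, map_zero]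
      neg_mem' := by
        intro a ha s
        rw [map_neg, neg_mul, map_neg, ha, map_neg, neg_mul] }
  refine hgen S ?_ ?_ r s
  · intro e s
    induction s using MvPolynomial.induction_on' with
    | monomial m b =>
      rw [hΦι, C_mul_monomial, rhoAdd_monomial, rhoAdd_monomial, hθ, mul_assoc]
    | add p q hp hq => rw [mul_add, map_add, hp, hq, map_add, mul_add]
  · intro j s
    induction s using MvPolynomial.induction_on' with
    | monomial m b =>
      rw [hΦx, X, monomial_mul, one_mul, rhoAdd_monomial, rhoAdd_monomial,
        Finsupp.prod_add_index' (by simp) (by intros; exact pow_add _ _ _)]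
      rw [Finsupp.prod_single_index (by simp), pow_one, map_mul]
      ring
    | add p q hp hq => rw [mul_add, map_add, hp, hq, map_add, mul_add]

lemma loc_finite {D R : Type u} {A' : Type u} [CommRing D] [CommRing R] [CommRing A'] [Algebra D A']
    (ι : D →+* R)
    (P : Ideal R) [P.IsPrime] [IsLocalization.AtPrime A' (P.comap ι)]
    (N : Type u) [AddCommGroup N] [Module R N] [Module A' N]
    (hsm : ∀ (e : D) (y : N), ι e • y = algebraMap D A' e • y) (hN : Module.Finite A' N) :
    Module.Finite (Localization.AtPrime P) (LocalizedModule P.primeCompl N) := by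
  obtain ⟨G, hG⟩ := hN.fg_top
  let f : N → LocalizedModule P.primeCompl N := fun y => LocalizedModule.mk y 1
  let W : Submodule (Localization.AtPrime P) (LocalizedModule P.primeCompl N) :=
    Submodule.span _ (f '' G)
  have hfr : ∀ (r : R) (y : N), f (r • y) = algebraMap R (Localization.AtPrime P) r • f y := by
    intro r y
    rw [algebraMap_smul]
    exact (LocalizedModule.smul'_mk r y 1).symm
  have hmem : ∀ y : N, f y ∈ W := by
    intro y
    have hy : y ∈ Submodule.span A' (G : Set N) := hG ▸ trivial
    induction hy using Submodule.span_induction with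
    | mem y hy => exact Submodule.subset_span ⟨y, hy, rfl⟩
    | zero =>
      have : f 0 = 0 := LocalizedModule.zero_mk 1
      rw [this]; exact W.zero_mem
    | add y z _ _ hy hz =>
      have : f (y + z) = f y + f z := by
        change LocalizedModule.mk (y + z) 1 = LocalizedModule.mk y 1 + LocalizedModule.mk z 1
        rw [LocalizedModule.mk_add_mk]
        simp
      rw [this]; exact W.add_mem hy hz
    | smul a y _ hy =>
      obtain ⟨⟨c, s⟩, hcs⟩ := IsLocalization.surj (P.comap ι).primeCompl a
      have h1 : ι s.1 • (a • y) = ι c • y := by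
        rw [hsm, hsm, smul_smul, mul_comm]
        exact congrArg (· • y) hcs
      have hs : ι s.1 ∈ P.primeCompl := s.2
      have hu : IsUnit (algebraMap R (Localization.AtPrime P) (ι s.1)) :=
        IsLocalization.map_units _ (⟨ι s.1, hs⟩ : P.primeCompl)
      have h2 : algebraMap R (Localization.AtPrime P) (ι s.1) • f (a • y) ∈ W := by
        rw [← hfr, h1, hfr]
        exact W.smul_mem _ hy
      obtain ⟨v, hv⟩ := hu
      have h3 := W.smul_mem (↑v⁻¹ : Localization.AtPrime P) h2
      rwa [smul_smul, ← hv, Units.inv_mul, one_smul] at h3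
  refine ⟨⟨(G.finite_toSet.image f).toFinset, ?_⟩⟩
  rw [Set.Finite.coe_toFinset, eq_top_iff]
  intro z _
  induction z using LocalizedModule.induction_on with
  | h y t =>
    have h2 : algebraMap R (Localization.AtPrime P) t.1 • LocalizedModule.mk y t ∈ W := by
      have : algebraMap R (Localization.AtPrime P) t.1 • LocalizedModule.mk y t = f y := by
        rw [algebraMap_smul]
        exact (LocalizedModule.smul'_mk t.1 y t).trans (LocalizedModule.mk_cancel t y)
      rw [this]
      exact hmem y
    obtain ⟨v, hv⟩ := IsLocalization.map_units (Localization.AtPrime P) t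
    have h3 := W.smul_mem (↑v⁻¹ : Localization.AtPrime P) h2
    rwa [smul_smul, ← hv, Units.inv_mul, one_smul] at h3

end S14
end BassLC

namespace BassLC

section S15
open MvPolynomial

lemma exists_prod {τ : Type} [Fintype τ] {D R : Type u} [CommRing D] [CommRing R]
    (ι : D →+* R) (x : τ → R) (P : Ideal R) [P.IsPrime]
    (hh : ∀ j, ∃ h : Polynomial D, Polynomial.eval₂ ι (x j) h ∈ P ∧
      h.leadingCoeff ∉ P.comap ι) :
    ∃ H : Polynomial D, (∀ j, Polynomial.eval₂ ι (x j) H ∈ P) ∧ H.leadingCoeff ∉ P.comap ι := by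
  classical
  choose h h1 h2 using hh
  have hlc : ∏ j, (h j).leadingCoeff ∉ P.comap ι := by
    intro hm
    obtain ⟨j, _, hj⟩ := (Ideal.IsPrime.prod_mem_iff (p := P.comap ι)).1 hm
    exact h2 j hj
  have hne : ∏ j, (h j).leadingCoeff ≠ 0 := fun h0 => hlc (h0 ▸ Ideal.zero_mem _)
  refine ⟨∏ j, h j, fun j => ?_, ?_⟩
  · rw [Polynomial.eval₂_finsetProd]
    exact P.mem_of_dvd (Finset.dvd_prod_of_mem _ (Finset.mem_univ j)) (h1 j)
  · rw [Polynomial.leadingCoeff_prod' _ _ hne]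
    exact hlc

theorem assemble {τ : Type} [DecidableEq τ] [Fintype τ] {D R : Type u} [CommRing D]
    [IsNoetherianRing D] [CommRing R] [IsNoetherianRing R] (ι : D →+* R) (x : τ → R)
    (hΦ : ∀ (B : Type u) [CommRing B] (β : D →+* B), ∃ Φ : R →+* MvPolynomial τ B,
      (∀ e, Φ (ι e) = C (β e)) ∧ ∀ j, Φ (x j) = X j)
    (hgen : ∀ S : Subring R, (∀ e, ι e ∈ S) → (∀ j, x j ∈ S) → ∀ r, r ∈ S)
    (I P : Ideal R) [P.IsPrime] (hp : P.comap ι ∈ minimalPrimes D)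
    (hh : ∀ j, ∃ h : Polynomial D, Polynomial.eval₂ ι (x j) h ∈ P ∧
      h.leadingCoeff ∉ P.comap ι) (i j : ℕ) :
    Module.Finite (Localization.AtPrime P)
      (bassExtModule R P j ((localCohomology I i).obj (ModuleCat.of R R))) := by
  obtain ⟨H, hH1, hH2⟩ := exists_prod ι x P hh
  let A' := Localization.AtPrime (P.comap ι)
  haveI : IsNoetherianRing A' := IsLocalization.isNoetherianRing (P.comap ι).primeCompl A' ‹_›
  haveI : Ring.KrullDimLE 0 A' := Ring.KrullDimLE.of_isLocalization (P.comap ι) hp A'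
  haveI : IsArtinianRing A' := IsNoetherianRing.isArtinianRing_of_krullDimLE_zero
  let α : D →+* A' := algebraMap D A'
  obtain ⟨u, hu⟩ : IsUnit (α H.leadingCoeff) :=
    IsLocalization.map_units A' (⟨_, hH2⟩ : (P.comap ι).primeCompl)
  have hlc : (H.map α).leadingCoeff = α H.leadingCoeff :=
    Polynomial.leadingCoeff_map_of_leadingCoeff_ne_zero _ (hu ▸ u.ne_zero)
  let g : Polynomial A' := Polynomial.C (↑u⁻¹ : A') * H.map α
  have hg : g.Monic := Polynomial.monic_C_mul_of_mul_leadingCoeff_eq_one (by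
    rw [hlc, ← hu, Units.inv_mul])
  have hgH : H.map α = Polynomial.C (α H.leadingCoeff) * g := by
    rw [← mul_assoc, ← Polynomial.C_mul, ← hu, Units.mul_inv, Polynomial.C_1, one_mul]
  obtain ⟨B, _, _, _, ρ0, L, hρ0, hL⟩ := exists_split g hg
  haveI : IsArtinianRing B := IsArtinianRing.of_finite A' B
  let β : D →+* B := (algebraMap A' B).comp α
  obtain ⟨Φ, hΦι, hΦx⟩ := hΦ B β
  letI : Algebra R (MvPolynomial τ B) := Φ.toAlgebra
  let θ0 : A' →+* Localization.AtPrime P := Localization.localRingHom (P.comap ι) P ι rfl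
  let θ : B →+ Localization.AtPrime P := θ0.toAddMonoidHom.comp ρ0.toAddMonoidHom
  have hθ : ∀ e b, θ (β e * b) = algebraMap R (Localization.AtPrime P) (ι e) * θ b := by
    intro e b
    change θ0 (ρ0 (algebraMap A' B (α e) * b)) = _ * θ0 (ρ0 b)
    rw [← Algebra.smul_def, map_smul, smul_eq_mul, map_mul]
    congr 1
    exact Localization.localRingHom_to_map _ _ _ _ _
  let ρ : MvPolynomial τ B →ₗ[R] Localization.AtPrime P :=
    { toFun := rhoAdd θ x
      map_add' := map_add _
      map_smul' := by
        intro r s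
        rw [Algebra.smul_def, RingHom.id_apply, Algebra.smul_def]
        exact rhoAdd_linear θ x ι β Φ hΦι hΦx hgen hθ r s }
  refine finish (B := B) (τ := τ) I P ρ ?_ ?_ ?_ i j
  · change rhoAdd θ x 1 = 1
    have : (1 : MvPolynomial τ B) = monomial 0 1 := rfl
    rw [this, rhoAdd_monomial]
    change θ0 (ρ0 1) * _ = 1
    rw [hρ0]
    simp
  · intro k
    refine ⟨L, ι H.leadingCoeff, Polynomial.eval₂ ι (x k) H, hH2, hH1 k, ?_⟩
    change Φ _ = Φ _ * _
    rw [Polynomial.hom_eval₂, hΦx, hΦι]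
    have e1 : Φ.comp ι = (C : B →+* MvPolynomial τ B).comp β := RingHom.ext hΦι
    have e2 : H.map β = Polynomial.C (β H.leadingCoeff) *
        (L.map (fun a => (Polynomial.X - Polynomial.C a))).prod := by
      rw [← hL, ← Polynomial.map_map, hgH, Polynomial.map_mul, Polynomial.map_C]
      rfl
    rw [e1, ← Polynomial.eval₂_map, e2, Polynomial.eval₂_mul, Polynomial.eval₂_C,
      Polynomial.eval₂_list_prod]
    congr 2
    rw [List.map_map]
    apply List.map_congr_left
    intro a _
    simp
  · intro N _ _ _ _ _ _ hN
    letI : Module A' N := Module.compHom N (algebraMap A' B)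
    haveI : IsScalarTower A' B N := ⟨fun a b y => by
      rw [Algebra.smul_def, mul_smul]; rfl⟩
    haveI : Module.Finite A' N := Module.Finite.trans B N
    refine loc_finite (A' := A') ι P N ?_ inferInstance
    intro e y
    have h1 : ι e • y = (Φ (ι e) : MvPolynomial τ B) • y := by
      have := algebraMap_smul (MvPolynomial τ B) (ι e) y
      exact this.symm
    have h2 : α e • y = (β e) • y := rfl
    change ι e • y = α e • y
    rw [h1, h2, hΦι]
    exact algebraMap_smul (MvPolynomial τ B) (β e) y

end S15

end BassLC

theorem bassNumbers_localCohomology_finite_of_dim_zero_polynomial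
    (A : Type u) [CommRing A] [IsNoetherianRing A] (hA : ringKrullDim A = 0)
    (n : ℕ) (I : Ideal (MvPolynomial (Fin n) A)) (i : ℕ)
    (P : Ideal (MvPolynomial (Fin n) A)) [P.IsPrime] (j : ℕ) :
    Module.Finite (Localization.AtPrime P)
      (bassExtModule _ P j
        ((localCohomology I i).obj (ModuleCat.of _ (MvPolynomial (Fin n) A)))) := by
  classical
  obtain ⟨T, hT, hh⟩ := BassLC.exists_T hA n P
  refine BassLC.assemble (τ := {k : Fin n // k ∉ T})
    (MvPolynomial.rename (R := A) (Subtype.val : {x // x ∈ T} → Fin n)).toRingHom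
    (fun k => MvPolynomial.X k.1) ?_ ?_ I P hT (fun k => hh k.1 k.2) i j
  · intro B _ β
    refine ⟨MvPolynomial.eval₂Hom (MvPolynomial.C.comp (β.comp MvPolynomial.C))
      (fun k => if h : k ∈ T then MvPolynomial.C (β (MvPolynomial.X ⟨k, h⟩))
        else MvPolynomial.X ⟨k, h⟩), ?_, ?_⟩
    · intro e
      have : (MvPolynomial.eval₂Hom (MvPolynomial.C.comp (β.comp MvPolynomial.C))
        (fun k => if h : k ∈ T then MvPolynomial.C (β (MvPolynomial.X ⟨k, h⟩))
        else (MvPolynomial.X ⟨k, h⟩ : MvPolynomial {k : Fin n // k ∉ T} B))).comp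
        (MvPolynomial.rename (R := A) (Subtype.val : {x // x ∈ T} → Fin n)).toRingHom =
        MvPolynomial.C.comp β := by
        apply MvPolynomial.ringHom_ext
        · intro r; simp
        · rintro ⟨k, hk⟩; simp [hk]
      exact RingHom.congr_fun this e
    · rintro ⟨k, hk⟩
      simp [hk]
  · intro S h1 h2 r
    induction r using MvPolynomial.induction_on with
    | C a => simpa using h1 (MvPolynomial.C a)
    | add p q hp hq => exact S.add_mem hp hq
    | mul_X p k hp =>
      refine S.mul_mem hp ?_
      by_cases hk : k ∈ T
      · simpa using h1 (MvPolynomial.X ⟨k, hk⟩)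
      · exact h2 ⟨k, hk⟩
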